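/- arXiv:2408.06992 — 3 statements merged into one kernel-verified Lean document; each statement's English description precedes it below -/
import Mathlib

section
/- Let T be a tournament on 6 vertices. Then δ_T = 0 or 3 ≤ δ_T ≤ 6, where δ_T is the number of diamonds in T. -/
open scoped Classical

/-- A tournament: irreflexive, and between distinct vertices exactly one arc. -/
def IsTournament {V : Type*} (r : V → V → Prop) : Prop :=
  (∀ i, ¬ r i i) ∧ ∀ i j, i ≠ j → (r i j ↔ ¬ r j i)

/-- Skew-adjacency matrix of a relation. -/
noncomputable def skew {V : Type*} (r : V → V → Prop) : Matrix V V ℤ :=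
  Matrix.of fun i j => if r i j then 1 else if r j i then -1 else 0

/-- Determinant of the skew-adjacency matrix. -/
noncomputable def tdet {V : Type*} [Fintype V] [DecidableEq V] (r : V → V → Prop) : ℤ :=
  (skew r).det

/-- Determinant of the subtournament induced by a finite vertex subset. -/
noncomputable def subdet {V : Type*} [Fintype V] [DecidableEq V] (r : V → V → Prop)
    (s : Finset V) : ℤ :=
  ((skew r).submatrix (fun x : {x // x ∈ s} => x.1) (fun x : {x // x ∈ s} => x.1)).det

/-- Switch of `r` with respect to `W`: arcs between `W` and its complement are reversed. -/
def switchRel {V : Type*} (r : V → V → Prop) (W : Set V) : V → V → Prop :=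
  fun i j => if (i ∈ W ↔ j ∈ W) then r i j else r j i

/-- Switching equivalence of two tournaments on the same vertex set. -/
def SwitchEquiv {V : Type*} (r₁ r₂ : V → V → Prop) : Prop :=
  ∃ W : Set V, ∀ i j, r₂ i j ↔ switchRel r₁ W i j

def IsTransitive {V : Type*} (r : V → V → Prop) : Prop :=
  ∀ a b c, r a b → r b c → r a c

def IsTransitiveOn {V : Type*} (r : V → V → Prop) (X : Finset V) : Prop :=
  ∀ a ∈ X, ∀ b ∈ X, ∀ c ∈ X, r a b → r b c → r a c

/-- A 4-set inducing a diamond: a vertex dominating or dominated by a 3-cycle. -/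
def IsDiamond {V : Type*} (r : V → V → Prop) (X : Finset V) : Prop :=
  ∃ a b c d : V, X = {a, b, c, d} ∧ a ≠ b ∧ a ≠ c ∧ a ≠ d ∧ b ≠ c ∧ b ≠ d ∧ c ≠ d ∧
    r b c ∧ r c d ∧ r d b ∧ ((r a b ∧ r a c ∧ r a d) ∨ (r b a ∧ r c a ∧ r d a))

/-- Number of diamonds of a tournament. -/
noncomputable def numDiamonds {V : Type*} [Fintype V] (r : V → V → Prop) : ℕ :=
  Set.ncard {X : Finset V | IsDiamond r X}

/-- The tournament `L_n`: a transitive chain `u_0 → ⋯ → u_{n-2}` together with a last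
vertex alternating along the chain, starting with `u_{n-1} → u_0`. -/
def LRel (n : ℕ) : Fin n → Fin n → Prop := fun i j =>
  (j.val < n - 1 ∧ i.val < j.val) ∨
  (j.val = n - 1 ∧ i.val < n - 1 ∧ i.val % 2 = 1) ∨
  (i.val = n - 1 ∧ j.val < n - 1 ∧ j.val % 2 = 0)

/-- Join of two tournaments: all arcs from the first to the second. -/
def joinRel {A B : Type*} (r : A → A → Prop) (s : B → B → Prop) : A ⊕ B → A ⊕ B → Prop :=
  fun x y => match x, y with
  | .inl a, .inl a' => r a a'
  | .inr b, .inr b' => s b b'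
  | .inl _, .inr _ => True
  | .inr _, .inl _ => False

/-- `T⁺`: add one new vertex dominated by every vertex of `T`. -/
def plusRel {A : Type*} (r : A → A → Prop) : Option A → Option A → Prop :=
  fun x y => match x, y with
  | some a, some b => r a b
  | some _, none => True
  | _, _ => False

/-- Blowup of `r` by the family of tournaments `t`. -/
def blowupG {ι : Type*} [DecidableEq ι] (r : ι → ι → Prop) {κ : ι → Type*}
    (t : ∀ i, κ i → κ i → Prop) : (Σ i, κ i) → (Σ i, κ i) → Prop :=
  fun x y => if h : x.1 = y.1 then t y.1 (h ▸ x.2) y.2 else r x.1 y.1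

/-- Transitive `(a_1,…,a_n)`-blowup of `r`. -/
def blowup {ι : Type*} [DecidableEq ι] (r : ι → ι → Prop) (a : ι → ℕ) :
    (Σ i, Fin (a i)) → (Σ i, Fin (a i)) → Prop :=
  blowupG r (fun _ p q => p < q)

/-- Membership in `𝒟_k`: every subtournament has determinant at most `k²`. -/
def memD {V : Type*} [Fintype V] [DecidableEq V] (r : V → V → Prop) (k : ℕ) : Prop :=
  ∀ s : Finset V, subdet r s ≤ (k : ℤ) ^ 2

/-- Boolean test for a diamond on four vertices from the six arcs `ab ac ad bc bd cd`. -/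
def diaB (ab ac ad bc bd cd : Bool) : Bool :=
  ((ab == cd) == (ad == bc)) && !((ab == cd) == (ac == bd))

theorem five_bool : ∀ ab ac ad ae bc bd be cd ce de : Bool,
    (diaB ab ac ad bc bd cd).toNat + (diaB ab ac ae bc be ce).toNat +
    (diaB ab ad ae bd be de).toNat + (diaB ac ad ae cd ce de).toNat +
    (diaB bc bd be cd ce de).toNat = 0 ∨
    (diaB ab ac ad bc bd cd).toNat + (diaB ab ac ae bc be ce).toNat +
    (diaB ab ad ae bd be de).toNat + (diaB ac ad ae cd ce de).toNat +
    (diaB bc bd be cd ce de).toNat = 2 := by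
  decide

/-- The test applied to a relation. -/
noncomputable def diaR {V : Type*} (r : V → V → Prop) (a b c d : V) : Bool :=
  diaB (decide (r a b)) (decide (r a c)) (decide (r a d)) (decide (r b c)) (decide (r b d))
    (decide (r c d))

theorem dia_of {V : Type*} (r : V → V → Prop) (hT : IsTournament r) (a b c d : V)
    (hab : a ≠ b) (hac : a ≠ c) (had : a ≠ d) (hbc : b ≠ c) (hbd : b ≠ d) (hcd : c ≠ d)
    (h : IsDiamond r {a, b, c, d}) : diaR r a b c d = true := by
  obtain ⟨x, y, z, w, hX, hxy, hxz, hxw, hyz, hyw, hzw, h1, h2, h3, h4⟩ := h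
  have hx : x ∈ ({a, b, c, d} : Finset V) := by rw [hX]; simp
  have hy : y ∈ ({a, b, c, d} : Finset V) := by rw [hX]; simp
  have hz : z ∈ ({a, b, c, d} : Finset V) := by rw [hX]; simp
  have hw : w ∈ ({a, b, c, d} : Finset V) := by rw [hX]; simp
  clear hX
  simp only [Finset.mem_insert, Finset.mem_singleton] at hx hy hz hw
  have e1 := hT.2 a b hab
  have e2 := hT.2 a c hac
  have e3 := hT.2 a d had
  have e4 := hT.2 b c hbc
  have e5 := hT.2 b d hbd
  have e6 := hT.2 c d hcd
  unfold diaR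
  rcases hx with rfl | rfl | rfl | rfl <;> rcases hy with rfl | rfl | rfl | rfl <;>
    first
    | exact absurd rfl hxy
    | (rcases hz with rfl | rfl | rfl | rfl <;>
        first
        | exact absurd rfl hxz
        | exact absurd rfl hyz
        | (rcases hw with rfl | rfl | rfl | rfl <;>
            first
            | exact absurd rfl hxw
            | exact absurd rfl hyw
            | exact absurd rfl hzw
            | (rcases h4 with ⟨h4, h5, h6⟩ | ⟨h4, h5, h6⟩ <;> simp_all [diaB])))

theorem bool_cfg : ∀ ab ac ad bc bd cd : Bool, diaB ab ac ad bc bd cd = true →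
    (((bc = true ∧ cd = true ∧ bd = false) ∨ (bc = false ∧ cd = false ∧ bd = true)) ∧
      ((ab = true ∧ ac = true ∧ ad = true) ∨ (ab = false ∧ ac = false ∧ ad = false))) ∨
    (((ac = true ∧ cd = true ∧ ad = false) ∨ (ac = false ∧ cd = false ∧ ad = true)) ∧
      ((ab = false ∧ bc = true ∧ bd = true) ∨ (ab = true ∧ bc = false ∧ bd = false))) ∨
    (((ab = true ∧ bd = true ∧ ad = false) ∨ (ab = false ∧ bd = false ∧ ad = true)) ∧
      ((ac = false ∧ bc = false ∧ cd = true) ∨ (ac = true ∧ bc = true ∧ cd = false))) ∨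
    (((ab = true ∧ bc = true ∧ ac = false) ∨ (ab = false ∧ bc = false ∧ ac = true)) ∧
      ((ad = false ∧ bd = false ∧ cd = false) ∨ (ad = true ∧ bd = true ∧ cd = true))) 
    := by
  intro ab ac ad bc bd cd
  cases ab <;> cases ac <;> cases ad <;> cases bc <;> cases bd <;> cases cd <;> simp [diaB]

theorem of_dia {V : Type*} (r : V → V → Prop) (hT : IsTournament r) (a b c d : V)
    (hab : a ≠ b) (hac : a ≠ c) (had : a ≠ d) (hbc : b ≠ c) (hbd : b ≠ d) (hcd : c ≠ d)
    (h : diaR r a b c d = true) : IsDiamond r {a, b, c, d} := by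
  have key : ∀ x y z w : V, ({a, b, c, d} : Finset V) = {x, y, z, w} →
      x ≠ y → x ≠ z → x ≠ w → y ≠ z → y ≠ w → z ≠ w →
      (((r y z ∧ r z w ∧ r w y) ∨ (r z y ∧ r w z ∧ r y w)) ∧
        ((r x y ∧ r x z ∧ r x w) ∨ (r y x ∧ r z x ∧ r w x))) →
      IsDiamond r {a, b, c, d} := by
    rintro x y z w hX h1 h2 h3 h4 h5 h6 ⟨⟨p, q, s⟩ | ⟨p, q, s⟩, h7⟩
    · exact ⟨x, y, z, w, hX, h1, h2, h3, h4, h5, h6, p, q, s, h7⟩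
    · refine ⟨x, w, z, y, ?_, h3, h2, h1, h6.symm, h5.symm, h4.symm, q, p, s,
        h7.imp (fun ⟨p, q, s⟩ => ⟨s, q, p⟩) (fun ⟨p, q, s⟩ => ⟨s, q, p⟩)⟩
      rw [hX]; clear * -; ext v; simp only [Finset.mem_insert, Finset.mem_singleton]; tauto
  have k1 := key a b c d rfl hab hac had hbc hbd hcd
  have k2 := key b a c d (by clear * -; ext v; simp only [Finset.mem_insert, Finset.mem_singleton]; tauto)
    hab.symm hbc hbd hac had hcd
  have k3 := key c a b d (by clear * -; ext v; simp only [Finset.mem_insert, Finset.mem_singleton]; tauto)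
    hac.symm hbc.symm hcd hab had hbd
  have k4 := key d a b c (by clear * -; ext v; simp only [Finset.mem_insert, Finset.mem_singleton]; tauto)
    had.symm hbd.symm hcd.symm hab hac hbc
  have e1 := hT.2 b a hab.symm
  have e2 := hT.2 c a hac.symm
  have e3 := hT.2 d a had.symm
  have e4 := hT.2 c b hbc.symm
  have e5 := hT.2 d b hbd.symm
  have e6 := hT.2 d c hcd.symm
  rw [e1, e2, e3, e4, e5, e6] at k1 k2 k3 k4
  have hb := bool_cfg _ _ _ _ _ _ h
  simp only [decide_eq_true_eq, decide_eq_false_iff_not] at hb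
  rcases hb with hb | hb | hb | hb
  · exact k1 hb
  · exact k2 hb
  · exact k3 hb
  · exact k4 hb

theorem numDiamonds_transfer {V W : Type*} [Fintype V] [Fintype W] (e : W ≃ V)
    (r : V → V → Prop) : numDiamonds r = numDiamonds (fun i j => r (e i) (e j)) := by
  unfold numDiamonds
  symm
  refine Set.ncard_congr (fun X _ => X.map e.toEmbedding) ?_ ?_ ?_
  · rintro X ⟨a, b, c, d, rfl, h⟩
    refine ⟨e a, e b, e c, e d, ?_, ?_⟩
    · simp [Finset.map_insert]
    · simpa using h
  · intro X Y _ _ h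
    exact Finset.map_injective _ h
  · rintro X ⟨a, b, c, d, rfl, h⟩
    refine ⟨{e.symm a, e.symm b, e.symm c, e.symm d},
      ⟨e.symm a, e.symm b, e.symm c, e.symm d, rfl, ?_⟩, ?_⟩
    · simpa using h
    · simp [Finset.map_insert]

theorem pow4 : Finset.powersetCard 4 (Finset.univ : Finset (Fin 6)) =
    {{0,1,2,3}, {0,1,2,4}, {0,1,2,5}, {0,1,3,4}, {0,1,3,5}, {0,1,4,5}, {0,2,3,4}, {0,2,3,5},
     {0,2,4,5}, {0,3,4,5}, {1,2,3,4}, {1,2,3,5}, {1,2,4,5}, {1,3,4,5}, {2,3,4,5}} := by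
  decide

theorem card_four {V : Type*} (a b c d : V)
    (hab : a ≠ b) (hac : a ≠ c) (had : a ≠ d) (hbc : b ≠ c) (hbd : b ≠ d) (hcd : c ≠ d) :
    ({a, b, c, d} : Finset V).card = 4 := by
  rw [Finset.card_insert_of_notMem, Finset.card_insert_of_notMem,
    Finset.card_insert_of_notMem, Finset.card_singleton] <;> simp [*]

theorem dia_iff {V : Type*} [DecidableEq V] (r : V → V → Prop) (hT : IsTournament r)
    (a b c d : V)
    (hab : a ≠ b) (hac : a ≠ c) (had : a ≠ d) (hbc : b ≠ c) (hbd : b ≠ d) (hcd : c ≠ d) :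
    IsDiamond r {a, b, c, d} ↔ diaR r a b c d = true := by
  have h : IsDiamond r (@insert V (Finset V) (@Finset.instInsert V (fun x y => Classical.propDecidable (x = y)))
      a (@insert V (Finset V) (@Finset.instInsert V (fun x y => Classical.propDecidable (x = y)))
      b (@insert V (Finset V) (@Finset.instInsert V (fun x y => Classical.propDecidable (x = y)))
      c {d}))) ↔ diaR r a b c d = true :=
    ⟨dia_of r hT a b c d hab hac had hbc hbd hcd, of_dia r hT a b c d hab hac had hbc hbd hcd⟩
  convert h

theorem num_eq (r : Fin 6 → Fin 6 → Prop) (hT : IsTournament r) :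
    numDiamonds r = (diaR r 0 1 2 3).toNat + (diaR r 0 1 2 4).toNat + (diaR r 0 1 2 5).toNat
    + (diaR r 0 1 3 4).toNat + (diaR r 0 1 3 5).toNat + (diaR r 0 1 4 5).toNat
    + (diaR r 0 2 3 4).toNat + (diaR r 0 2 3 5).toNat + (diaR r 0 2 4 5).toNat
    + (diaR r 0 3 4 5).toNat + (diaR r 1 2 3 4).toNat + (diaR r 1 2 3 5).toNat
    + (diaR r 1 2 4 5).toNat + (diaR r 1 3 4 5).toNat + (diaR r 2 3 4 5).toNat := by
  have hs : {X : Finset (Fin 6) | IsDiamond r X} =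
      ↑((Finset.powersetCard 4 (Finset.univ : Finset (Fin 6))).filter (IsDiamond r)) := by
    ext X
    simp only [Set.mem_ofPred_eq, Finset.coe_filter, Finset.mem_powersetCard, Finset.subset_univ,
      true_and]
    constructor
    · intro h
      refine ⟨?_, h⟩
      obtain ⟨a, b, c, d, rfl, h1, h2, h3, h4, h5, h6, _⟩ := h
      exact card_four a b c d h1 h2 h3 h4 h5 h6
    · exact fun h => h.2
  have hd : ∀ a b c d : Fin 6, a ≠ b → a ≠ c → a ≠ d → b ≠ c → b ≠ d → c ≠ d →
      (if IsDiamond r {a, b, c, d} then 1 else 0) = (diaR r a b c d).toNat := by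
    intro a b c d h1 h2 h3 h4 h5 h6
    by_cases h : diaR r a b c d = true
    · rw [if_pos ((dia_iff r hT a b c d h1 h2 h3 h4 h5 h6).2 h), h]; rfl
    · rw [if_neg (fun h' => h ((dia_iff r hT a b c d h1 h2 h3 h4 h5 h6).1 h'))]
      rw [Bool.not_eq_true] at h
      rw [h]; rfl
  unfold numDiamonds
  rw [hs, Set.ncard_coe_finset, Finset.card_filter, pow4]
  repeat rw [Finset.sum_insert (by decide)]
  rw [Finset.sum_singleton]
  repeat rw [hd _ _ _ _ (by decide) (by decide) (by decide) (by decide) (by decide) (by decide)]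
  ring

theorem five_rel {V : Type*} (r : V → V → Prop) (a b c d e : V) :
    (diaR r a b c d).toNat + (diaR r a b c e).toNat + (diaR r a b d e).toNat +
    (diaR r a c d e).toNat + (diaR r b c d e).toNat = 0 ∨
    (diaR r a b c d).toNat + (diaR r a b c e).toNat + (diaR r a b d e).toNat +
    (diaR r a c d e).toNat + (diaR r b c d e).toNat = 2 :=
  five_bool _ _ _ _ _ _ _ _ _ _

theorem stmt8 {V : Type*} [Fintype V] [DecidableEq V] (r : V → V → Prop)
    (hT : IsTournament r) (hcard : Fintype.card V = 6) :
    numDiamonds r = 0 ∨ (3 ≤ numDiamonds r ∧ numDiamonds r ≤ 6) := by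
  have e : Fin 6 ≃ V := (Fintype.equivFinOfCardEq hcard).symm
  rw [numDiamonds_transfer e r]
  have hT' : IsTournament (fun i j => r (e i) (e j)) :=
    ⟨fun i => hT.1 _, fun i j h => hT.2 _ _ (fun h' => h (e.injective h'))⟩
  generalize (fun i j => r (e i) (e j)) = s at hT'
  rw [num_eq s hT']
  have h0 := five_rel s 1 2 3 4 5
  have h1 := five_rel s 0 2 3 4 5
  have h2 := five_rel s 0 1 3 4 5
  have h3 := five_rel s 0 1 2 4 5
  have h4 := five_rel s 0 1 2 3 5
  have h5 := five_rel s 0 1 2 3 4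
  have b1 := Bool.toNat_le (diaR s 0 1 2 3)
  have b2 := Bool.toNat_le (diaR s 0 1 2 4)
  have b3 := Bool.toNat_le (diaR s 0 1 2 5)
  have b4 := Bool.toNat_le (diaR s 0 1 3 4)
  have b5 := Bool.toNat_le (diaR s 0 1 3 5)
  have b6 := Bool.toNat_le (diaR s 0 1 4 5)
  have b7 := Bool.toNat_le (diaR s 0 2 3 4)
  have b8 := Bool.toNat_le (diaR s 0 2 3 5)
  have b9 := Bool.toNat_le (diaR s 0 2 4 5)
  have b10 := Bool.toNat_le (diaR s 0 3 4 5)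
  have b11 := Bool.toNat_le (diaR s 1 2 3 4)
  have b12 := Bool.toNat_le (diaR s 1 2 3 5)
  have b13 := Bool.toNat_le (diaR s 1 2 4 5)
  have b14 := Bool.toNat_le (diaR s 1 3 4 5)
  have b15 := Bool.toNat_le (diaR s 2 3 4 5)
  generalize (diaR s 0 1 2 3).toNat = x1 at *
  generalize (diaR s 0 1 2 4).toNat = x2 at *
  generalize (diaR s 0 1 2 5).toNat = x3 at *
  generalize (diaR s 0 1 3 4).toNat = x4 at *
  generalize (diaR s 0 1 3 5).toNat = x5 at *
  generalize (diaR s 0 1 4 5).toNat = x6 at *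
  generalize (diaR s 0 2 3 4).toNat = x7 at *
  generalize (diaR s 0 2 3 5).toNat = x8 at *
  generalize (diaR s 0 2 4 5).toNat = x9 at *
  generalize (diaR s 0 3 4 5).toNat = x10 at *
  generalize (diaR s 1 2 3 4).toNat = x11 at *
  generalize (diaR s 1 2 3 5).toNat = x12 at *
  generalize (diaR s 1 2 4 5).toNat = x13 at *
  generalize (diaR s 1 3 4 5).toNat = x14 at *
  generalize (diaR s 2 3 4 5).toNat = x15 at *
  have up : x1 + x2 + x3 + x4 + x5 + x6 + x7 + x8 + x9 + x10 + x11 + x12 + x13 + x14 + x15 ≤ 6 := by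
    have s0 : x11 + x12 + x13 + x14 + x15 ≤ 2 := by clear * - h0; omega
    have s1 : x7 + x8 + x9 + x10 + x15 ≤ 2 := by clear * - h1; omega
    have s2 : x4 + x5 + x6 + x10 + x14 ≤ 2 := by clear * - h2; omega
    have s3 : x2 + x3 + x6 + x9 + x13 ≤ 2 := by clear * - h3; omega
    have s4 : x1 + x3 + x5 + x8 + x12 ≤ 2 := by clear * - h4; omega
    have s5 : x1 + x2 + x4 + x7 + x11 ≤ 2 := by clear * - h5; omega
    clear * - s0 s1 s2 s3 s4 s5; omega
  have c1 : x1 = 0 ∨ 3 ≤ x1 + x2 + x3 + x4 + x5 + x6 + x7 + x8 + x9 + x10 + x11 + x12 + x13 + x14 + x15 := by clear * - h4 h5 b1; omega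
  have c2 : x2 = 0 ∨ 3 ≤ x1 + x2 + x3 + x4 + x5 + x6 + x7 + x8 + x9 + x10 + x11 + x12 + x13 + x14 + x15 := by clear * - h3 h5 b2; omega
  have c3 : x3 = 0 ∨ 3 ≤ x1 + x2 + x3 + x4 + x5 + x6 + x7 + x8 + x9 + x10 + x11 + x12 + x13 + x14 + x15 := by clear * - h3 h4 b3; omega
  have c4 : x4 = 0 ∨ 3 ≤ x1 + x2 + x3 + x4 + x5 + x6 + x7 + x8 + x9 + x10 + x11 + x12 + x13 + x14 + x15 := by clear * - h2 h5 b4; omega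
  have c5 : x5 = 0 ∨ 3 ≤ x1 + x2 + x3 + x4 + x5 + x6 + x7 + x8 + x9 + x10 + x11 + x12 + x13 + x14 + x15 := by clear * - h2 h4 b5; omega
  have c6 : x6 = 0 ∨ 3 ≤ x1 + x2 + x3 + x4 + x5 + x6 + x7 + x8 + x9 + x10 + x11 + x12 + x13 + x14 + x15 := by clear * - h2 h3 b6; omega
  have c7 : x7 = 0 ∨ 3 ≤ x1 + x2 + x3 + x4 + x5 + x6 + x7 + x8 + x9 + x10 + x11 + x12 + x13 + x14 + x15 := by clear * - h1 h5 b7; omega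
  have c8 : x8 = 0 ∨ 3 ≤ x1 + x2 + x3 + x4 + x5 + x6 + x7 + x8 + x9 + x10 + x11 + x12 + x13 + x14 + x15 := by clear * - h1 h4 b8; omega
  have c9 : x9 = 0 ∨ 3 ≤ x1 + x2 + x3 + x4 + x5 + x6 + x7 + x8 + x9 + x10 + x11 + x12 + x13 + x14 + x15 := by clear * - h1 h3 b9; omega
  have c10 : x10 = 0 ∨ 3 ≤ x1 + x2 + x3 + x4 + x5 + x6 + x7 + x8 + x9 + x10 + x11 + x12 + x13 + x14 + x15 := by clear * - h1 h2 b10; omega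
  have c11 : x11 = 0 ∨ 3 ≤ x1 + x2 + x3 + x4 + x5 + x6 + x7 + x8 + x9 + x10 + x11 + x12 + x13 + x14 + x15 := by clear * - h0 h5 b11; omega
  have c12 : x12 = 0 ∨ 3 ≤ x1 + x2 + x3 + x4 + x5 + x6 + x7 + x8 + x9 + x10 + x11 + x12 + x13 + x14 + x15 := by clear * - h0 h4 b12; omega
  have c13 : x13 = 0 ∨ 3 ≤ x1 + x2 + x3 + x4 + x5 + x6 + x7 + x8 + x9 + x10 + x11 + x12 + x13 + x14 + x15 := by clear * - h0 h3 b13; omega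
  have c14 : x14 = 0 ∨ 3 ≤ x1 + x2 + x3 + x4 + x5 + x6 + x7 + x8 + x9 + x10 + x11 + x12 + x13 + x14 + x15 := by clear * - h0 h2 b14; omega
  have c15 : x15 = 0 ∨ 3 ≤ x1 + x2 + x3 + x4 + x5 + x6 + x7 + x8 + x9 + x10 + x11 + x12 + x13 + x14 + x15 := by clear * - h0 h1 b15; omega
  clear * - up c1 c2 c3 c4 c5 c6 c7 c8 c9 c10 c11 c12 c13 c14 c15
  by_cases hN : 3 ≤ x1 + x2 + x3 + x4 + x5 + x6 + x7 + x8 + x9 + x10 + x11 + x12 + x13 + x14 + x15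
  · exact Or.inr ⟨hN, up⟩
  · left
    simp only [hN, or_false] at c1 c2 c3 c4 c5 c6 c7 c8 c9 c10 c11 c12 c13 c14 c15
    omega
end

section
/- Let T be a tournament on 6 vertices. Then det(T) = 1 if δ_T = 0; det(T) ∈ {1, 9} if δ_T ∈ {3, 4}; det(T) = 25 if δ_T = 5; and det(T) ∈ {49, 81} if δ_T = 6. -/
open scoped Classical

/-- The Pfaffian of a generic skew-symmetric matrix of order six. -/
def pfSix (x01 x02 x03 x04 x05 x12 x13 x14 x15 x23 x24 x25 x34 x35 x45 : ℤ) : ℤ :=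
  x01 * (x23 * x45 - x24 * x35 + x25 * x34) - x02 * (x13 * x45 - x14 * x35 + x15 * x34) + x03 * (x12 * x45 - x14 * x25 + x15 * x24) - x04 * (x12 * x35 - x13 * x25 + x15 * x23) + x05 * (x12 * x34 - x13 * x24 + x14 * x23)

/-- The Pfaffian of a generic skew-symmetric matrix of order four. -/
def pfFour (a b c d e f : ℤ) : ℤ := a * f - b * e + c * d

/-- Sum of the squares of the fifteen Pfaffian minors of order four. -/
def minorSum (x01 x02 x03 x04 x05 x12 x13 x14 x15 x23 x24 x25 x34 x35 x45 : ℤ) : ℤ :=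
  pfFour x01 x02 x03 x12 x13 x23 ^ 2 +
  pfFour x01 x02 x04 x12 x14 x24 ^ 2 +
  pfFour x01 x02 x05 x12 x15 x25 ^ 2 +
  pfFour x01 x03 x04 x13 x14 x34 ^ 2 +
  pfFour x01 x03 x05 x13 x15 x35 ^ 2 +
  pfFour x01 x04 x05 x14 x15 x45 ^ 2 +
  pfFour x02 x03 x04 x23 x24 x34 ^ 2 +
  pfFour x02 x03 x05 x23 x25 x35 ^ 2 +
  pfFour x02 x04 x05 x24 x25 x45 ^ 2 +
  pfFour x03 x04 x05 x34 x35 x45 ^ 2 +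
  pfFour x12 x13 x14 x23 x24 x34 ^ 2 +
  pfFour x12 x13 x15 x23 x25 x35 ^ 2 +
  pfFour x12 x14 x15 x24 x25 x45 ^ 2 +
  pfFour x13 x14 x15 x34 x35 x45 ^ 2 +
  pfFour x23 x24 x25 x34 x35 x45 ^ 2

theorem det_eq_pfSix (x01 x02 x03 x04 x05 x12 x13 x14 x15 x23 x24 x25 x34 x35 x45 : ℤ) :
    Matrix.det !![0, x01, x02, x03, x04, x05;
      -x01, 0, x12, x13, x14, x15;
      -x02, -x12, 0, x23, x24, x25;
      -x03, -x13, -x23, 0, x34, x35;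
      -x04, -x14, -x24, -x34, 0, x45;
      -x05, -x15, -x25, -x35, -x45, 0] =
      pfSix x01 x02 x03 x04 x05 x12 x13 x14 x15 x23 x24 x25 x34 x35 x45 ^ 2 := by
  simp [Matrix.det_succ_row_zero, Fin.sum_univ_succ, Fin.succAbove, pfSix]
  ring

/-- The claimed relation between the sum of squares of minors and the determinant. -/
def Good (s p : ℤ) : Prop :=
  (s = 15 → p = 1) ∧ (s = 39 ∨ s = 47 → p = 1 ∨ p = 9) ∧ (s = 55 → p = 25) ∧
    (s = 63 → p = 49 ∨ p = 81)

instance (s p : ℤ) : Decidable (Good s p) := by unfold Good; infer_instance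

def sgn (b : Bool) : ℤ := if b then 1 else -1

theorem good_bool : ∀ b12 b13 b14 b15 b23 b24 b25 b34 b35 b45 : Bool,
    Good (minorSum 1 1 1 1 1 (sgn b12) (sgn b13) (sgn b14) (sgn b15) (sgn b23) (sgn b24) (sgn b25) (sgn b34) (sgn b35) (sgn b45))
      (pfSix 1 1 1 1 1 (sgn b12) (sgn b13) (sgn b14) (sgn b15) (sgn b23) (sgn b24) (sgn b25) (sgn b34) (sgn b35) (sgn b45) ^ 2) := by
  decide +kernel

theorem exists_sgn {x : ℤ} (h : x = 1 ∨ x = -1) : ∃ b, x = sgn b := by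
  rcases h with h | h
  · exact ⟨true, h⟩
  · exact ⟨false, h⟩

theorem good_normal (x12 x13 x14 x15 x23 x24 x25 x34 x35 x45 : ℤ)
    (hx12 : x12 = 1 ∨ x12 = -1)
    (hx13 : x13 = 1 ∨ x13 = -1)
    (hx14 : x14 = 1 ∨ x14 = -1)
    (hx15 : x15 = 1 ∨ x15 = -1)
    (hx23 : x23 = 1 ∨ x23 = -1)
    (hx24 : x24 = 1 ∨ x24 = -1)
    (hx25 : x25 = 1 ∨ x25 = -1)
    (hx34 : x34 = 1 ∨ x34 = -1)
    (hx35 : x35 = 1 ∨ x35 = -1)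
    (hx45 : x45 = 1 ∨ x45 = -1) :
    Good (minorSum 1 1 1 1 1 x12 x13 x14 x15 x23 x24 x25 x34 x35 x45) (pfSix 1 1 1 1 1 x12 x13 x14 x15 x23 x24 x25 x34 x35 x45 ^ 2) := by
  obtain ⟨bx12, rfl⟩ := exists_sgn hx12
  obtain ⟨bx13, rfl⟩ := exists_sgn hx13
  obtain ⟨bx14, rfl⟩ := exists_sgn hx14
  obtain ⟨bx15, rfl⟩ := exists_sgn hx15
  obtain ⟨bx23, rfl⟩ := exists_sgn hx23
  obtain ⟨bx24, rfl⟩ := exists_sgn hx24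
  obtain ⟨bx25, rfl⟩ := exists_sgn hx25
  obtain ⟨bx34, rfl⟩ := exists_sgn hx34
  obtain ⟨bx35, rfl⟩ := exists_sgn hx35
  obtain ⟨bx45, rfl⟩ := exists_sgn hx45
  exact good_bool _ _ _ _ _ _ _ _ _ _

theorem mul_three {a b c : ℤ} (ha : a = 1 ∨ a = -1) (hb : b = 1 ∨ b = -1)
    (hc : c = 1 ∨ c = -1) : a * b * c = 1 ∨ a * b * c = -1 := by
  rcases ha with rfl | rfl <;> rcases hb with rfl | rfl <;> rcases hc with rfl | rfl <;> simp

theorem good_all (x01 x02 x03 x04 x05 x12 x13 x14 x15 x23 x24 x25 x34 x35 x45 : ℤ)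
    (hx01 : x01 = 1 ∨ x01 = -1)
    (hx02 : x02 = 1 ∨ x02 = -1)
    (hx03 : x03 = 1 ∨ x03 = -1)
    (hx04 : x04 = 1 ∨ x04 = -1)
    (hx05 : x05 = 1 ∨ x05 = -1)
    (hx12 : x12 = 1 ∨ x12 = -1)
    (hx13 : x13 = 1 ∨ x13 = -1)
    (hx14 : x14 = 1 ∨ x14 = -1)
    (hx15 : x15 = 1 ∨ x15 = -1)
    (hx23 : x23 = 1 ∨ x23 = -1)
    (hx24 : x24 = 1 ∨ x24 = -1)
    (hx25 : x25 = 1 ∨ x25 = -1)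
    (hx34 : x34 = 1 ∨ x34 = -1)
    (hx35 : x35 = 1 ∨ x35 = -1)
    (hx45 : x45 = 1 ∨ x45 = -1) :
    Good (minorSum x01 x02 x03 x04 x05 x12 x13 x14 x15 x23 x24 x25 x34 x35 x45) (pfSix x01 x02 x03 x04 x05 x12 x13 x14 x15 x23 x24 x25 x34 x35 x45 ^ 2) := by
  have key := good_normal (x01 * x02 * x12) (x01 * x03 * x13) (x01 * x04 * x14) (x01 * x05 * x15) (x02 * x03 * x23) (x02 * x04 * x24) (x02 * x05 * x25) (x03 * x04 * x34) (x03 * x05 * x35) (x04 * x05 * x45)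
    (mul_three hx01 hx02 hx12)
    (mul_three hx01 hx03 hx13)
    (mul_three hx01 hx04 hx14)
    (mul_three hx01 hx05 hx15)
    (mul_three hx02 hx03 hx23)
    (mul_three hx02 hx04 hx24)
    (mul_three hx02 hx05 hx25)
    (mul_three hx03 hx04 hx34)
    (mul_three hx03 hx05 hx35)
    (mul_three hx04 hx05 hx45)
  have e1 : minorSum 1 1 1 1 1 (x01 * x02 * x12) (x01 * x03 * x13) (x01 * x04 * x14) (x01 * x05 * x15) (x02 * x03 * x23) (x02 * x04 * x24) (x02 * x05 * x25) (x03 * x04 * x34) (x03 * x05 * x35) (x04 * x05 * x45) = minorSum x01 x02 x03 x04 x05 x12 x13 x14 x15 x23 x24 x25 x34 x35 x45 := by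
    clear key
    rcases hx01 with rfl | rfl <;> rcases hx02 with rfl | rfl <;> rcases hx03 with rfl | rfl <;>
      rcases hx04 with rfl | rfl <;> rcases hx05 with rfl | rfl <;>
      simp only [minorSum, pfFour] <;> ring
  have e2 : pfSix 1 1 1 1 1 (x01 * x02 * x12) (x01 * x03 * x13) (x01 * x04 * x14) (x01 * x05 * x15) (x02 * x03 * x23) (x02 * x04 * x24) (x02 * x05 * x25) (x03 * x04 * x34) (x03 * x05 * x35) (x04 * x05 * x45) ^ 2 = pfSix x01 x02 x03 x04 x05 x12 x13 x14 x15 x23 x24 x25 x34 x35 x45 ^ 2 := by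
    clear key e1
    rcases hx01 with rfl | rfl <;> rcases hx02 with rfl | rfl <;> rcases hx03 with rfl | rfl <;>
      rcases hx04 with rfl | rfl <;> rcases hx05 with rfl | rfl <;>
      simp only [pfSix] <;> ring
  rwa [e1, e2] at key

theorem skew_self {V : Type*} {r : V → V → Prop} (hT : IsTournament r) (i : V) :
    skew r i i = 0 := by
  simp [skew, hT.1 i]

theorem skew_swap {V : Type*} {r : V → V → Prop} (hT : IsTournament r) (i j : V) :
    skew r j i = - skew r i j := by
  by_cases h : i = j
  · subst h; simp [skew_self hT]
  · have := hT.2 i j h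
    by_cases h1 : r i j <;> by_cases h2 : r j i <;> simp_all [skew]

theorem skew_pm {V : Type*} {r : V → V → Prop} (hT : IsTournament r) {i j : V} (h : i ≠ j) :
    skew r i j = 1 ∨ skew r i j = -1 := by
  have := hT.2 i j h
  by_cases h1 : r i j <;> by_cases h2 : r j i <;> simp_all [skew]

theorem skew_eq_one {V : Type*} {r : V → V → Prop} (_hT : IsTournament r) {i j : V} :
    skew r i j = 1 ↔ r i j := by
  by_cases h1 : r i j <;> by_cases h2 : r j i <;> simp_all [skew]

/-- The order-four Pfaffian of four vertices. -/
noncomputable def pfv {V : Type*} (r : V → V → Prop) (a b c d : V) : ℤ :=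
  pfFour (skew r a b) (skew r a c) (skew r a d) (skew r b c) (skew r b d) (skew r c d)

theorem pfv_sq_perm {V : Type*} {r : V → V → Prop} (hT : IsTournament r)
    {a b c d a' b' c' d' : V} (ha : a' ∈ ({a, b, c, d} : Finset V))
    (hb : b' ∈ ({a, b, c, d} : Finset V)) (hc : c' ∈ ({a, b, c, d} : Finset V))
    (hd : d' ∈ ({a, b, c, d} : Finset V))
    (h1 : a' ≠ b') (h2 : a' ≠ c') (h3 : a' ≠ d') (h4 : b' ≠ c') (h5 : b' ≠ d') (h6 : c' ≠ d') :
    pfv r a' b' c' d' ^ 2 = pfv r a b c d ^ 2 := by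
  have e1 := skew_swap hT a b
  have e2 := skew_swap hT a c
  have e3 := skew_swap hT a d
  have e4 := skew_swap hT b c
  have e5 := skew_swap hT b d
  have e6 := skew_swap hT c d
  simp only [Finset.mem_insert, Finset.mem_singleton] at ha hb hc hd
  rcases ha with rfl | rfl | rfl | rfl <;> rcases hb with rfl | rfl | rfl | rfl <;>
    first
    | exact absurd rfl h1
    | (rcases hc with rfl | rfl | rfl | rfl <;>
        first
        | exact absurd rfl h2
        | exact absurd rfl h4
        | (rcases hd with rfl | rfl | rfl | rfl <;>
            first
            | exact absurd rfl h3
            | exact absurd rfl h5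
            | exact absurd rfl h6
            | (simp only [pfv, pfFour, e1, e2, e3, e4, e5, e6] <;> ring)))

theorem diamond_pfv {V : Type*} {r : V → V → Prop} (hT : IsTournament r) {a b c d : V}
    (hab : a ≠ b) (hac : a ≠ c) (had : a ≠ d) (hbc : b ≠ c) (hbd : b ≠ d) (hcd : c ≠ d)
    (X : Finset V) (hS : X = {a, b, c, d}) :
    8 * (if IsDiamond r X then (1 : ℤ) else 0) + 1 = pfv r a b c d ^ 2 := by
  subst hS
  have e1 := skew_swap hT a b
  have e2 := skew_swap hT a c
  have e3 := skew_swap hT a d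
  have e4 := skew_swap hT b c
  have e5 := skew_swap hT b d
  have e6 := skew_swap hT c d
  split_ifs with h
  · obtain ⟨a', b', c', d', hX, h1, h2, h3, h4, h5, h6, k1, k2, k3, hk⟩ := h
    rw [← pfv_sq_perm hT (a' := a') (b' := b') (c' := c') (d' := d') (by simp [hX])
      (by simp [hX]) (by simp [hX]) (by simp [hX]) h1 h2 h3 h4 h5 h6]
    rw [← skew_eq_one hT] at k1 k2 k3
    have k4 := skew_swap hT d' b'
    rcases hk with ⟨m1, m2, m3⟩ | ⟨m1, m2, m3⟩ <;> rw [← skew_eq_one hT] at m1 m2 m3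
    · simp [pfv, pfFour, k1, k2, k3, k4, m1, m2, m3]
    · have n1 := skew_swap hT b' a'
      have n2 := skew_swap hT c' a'
      have n3 := skew_swap hT d' a'
      simp [pfv, pfFour, k1, k2, k3, k4, m1, m2, m3, n1, n2, n3]
  · have perm : ∀ p q s t : V, ({a, b, c, d} : Finset V) = {p, q, s, t} →
        p ≠ q → p ≠ s → p ≠ t → q ≠ s → q ≠ t → s ≠ t →
        ¬ (skew r q s = 1 ∧ skew r s t = 1 ∧ skew r t q = 1 ∧
          ((skew r p q = 1 ∧ skew r p s = 1 ∧ skew r p t = 1) ∨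
           (skew r q p = 1 ∧ skew r s p = 1 ∧ skew r t p = 1))) := by
      intro p q s t hX h1 h2 h3 h4 h5 h6 hh
      simp only [skew_eq_one hT] at hh
      exact h ⟨p, q, s, t, hX, h1, h2, h3, h4, h5, h6, hh⟩
    have p1 := perm a b c d rfl hab hac had hbc hbd hcd
    have p2 := perm a b d c (by grind) hab had hac hbd hbc hcd.symm
    have p3 := perm b a c d (by grind) hab.symm hbc hbd hac had hcd
    have p4 := perm b a d c (by grind) hab.symm hbd hbc had hac hcd.symm
    have p5 := perm c a b d (by grind) hac.symm hbc.symm hcd hab had hbd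
    have p6 := perm c a d b (by grind) hac.symm hcd hbc.symm had hab hbd.symm
    have p7 := perm d a b c (by grind) had.symm hbd.symm hcd.symm hab hac hbc
    have p8 := perm d a c b (by grind) had.symm hcd.symm hbd.symm hac hab hbc.symm
    clear perm
    rw [e1, e2, e3, e4, e5, e6] at *
    unfold pfv
    rcases skew_pm hT hab with w1 | w1 <;> rcases skew_pm hT hac with w2 | w2 <;>
    rcases skew_pm hT had with w3 | w3 <;> rcases skew_pm hT hbc with w4 | w4 <;>
    rcases skew_pm hT hbd with w5 | w5 <;> rcases skew_pm hT hcd with w6 | w6 <;>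
    simp only [w1, w2, w3, w4, w5, w6] at p1 p2 p3 p4 p5 p6 p7 p8 ⊢ <;>
    first
    | (norm_num [pfFour]; done)
    | (exfalso; apply p1; norm_num; done)
    | (exfalso; apply p2; norm_num; done)
    | (exfalso; apply p3; norm_num; done)
    | (exfalso; apply p4; norm_num; done)
    | (exfalso; apply p5; norm_num; done)
    | (exfalso; apply p6; norm_num; done)
    | (exfalso; apply p7; norm_num; done)
    | (exfalso; apply p8; norm_num; done)

theorem numDiamonds_fin {r : Fin 6 → Fin 6 → Prop} (hT : IsTournament r) :
    8 * (numDiamonds r : ℤ) + 15 = minorSum (skew r 0 1) (skew r 0 2) (skew r 0 3) (skew r 0 4) (skew r 0 5) (skew r 1 2) (skew r 1 3) (skew r 1 4) (skew r 1 5) (skew r 2 3) (skew r 2 4) (skew r 2 5) (skew r 3 4) (skew r 3 5) (skew r 4 5) := by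
  have hS : {X : Finset (Fin 6) | IsDiamond r X} =
      ↑(((Finset.univ : Finset (Fin 6)).powersetCard 4).filter (fun X => IsDiamond r X)) := by
    ext X
    simp only [Set.mem_ofPred_eq, Finset.coe_filter, Finset.mem_powersetCard]
    refine ⟨fun h => ⟨⟨Finset.subset_univ _, ?_⟩, h⟩, fun h => h.2⟩
    obtain ⟨a', b', c', d', hX, h1, h2, h3, h4, h5, h6, -⟩ := h
    subst hX
    simp [h1, h2, h3, h4, h5, h6]
  have hlist : (Finset.univ : Finset (Fin 6)).powersetCard 4 =
      {{0, 1, 2, 3}, {0, 1, 2, 4}, {0, 1, 2, 5}, {0, 1, 3, 4}, {0, 1, 3, 5}, {0, 1, 4, 5}, {0, 2, 3, 4}, {0, 2, 3, 5}, {0, 2, 4, 5}, {0, 3, 4, 5}, {1, 2, 3, 4}, {1, 2, 3, 5}, {1, 2, 4, 5}, {1, 3, 4, 5}, {2, 3, 4, 5}} := by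
    decide
  unfold numDiamonds
  rw [hS, Set.ncard_coe_finset, Finset.card_filter, hlist]
  push_cast
  have q0123 := diamond_pfv hT (a := 0) (b := 1) (c := 2) (d := 3)
    (by decide) (by decide) (by decide) (by decide) (by decide) (by decide)
    {0, 1, 2, 3} (by ext; simp)
  have q0124 := diamond_pfv hT (a := 0) (b := 1) (c := 2) (d := 4)
    (by decide) (by decide) (by decide) (by decide) (by decide) (by decide)
    {0, 1, 2, 4} (by ext; simp)
  have q0125 := diamond_pfv hT (a := 0) (b := 1) (c := 2) (d := 5)
    (by decide) (by decide) (by decide) (by decide) (by decide) (by decide)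
    {0, 1, 2, 5} (by ext; simp)
  have q0134 := diamond_pfv hT (a := 0) (b := 1) (c := 3) (d := 4)
    (by decide) (by decide) (by decide) (by decide) (by decide) (by decide)
    {0, 1, 3, 4} (by ext; simp)
  have q0135 := diamond_pfv hT (a := 0) (b := 1) (c := 3) (d := 5)
    (by decide) (by decide) (by decide) (by decide) (by decide) (by decide)
    {0, 1, 3, 5} (by ext; simp)
  have q0145 := diamond_pfv hT (a := 0) (b := 1) (c := 4) (d := 5)
    (by decide) (by decide) (by decide) (by decide) (by decide) (by decide)
    {0, 1, 4, 5} (by ext; simp)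
  have q0234 := diamond_pfv hT (a := 0) (b := 2) (c := 3) (d := 4)
    (by decide) (by decide) (by decide) (by decide) (by decide) (by decide)
    {0, 2, 3, 4} (by ext; simp)
  have q0235 := diamond_pfv hT (a := 0) (b := 2) (c := 3) (d := 5)
    (by decide) (by decide) (by decide) (by decide) (by decide) (by decide)
    {0, 2, 3, 5} (by ext; simp)
  have q0245 := diamond_pfv hT (a := 0) (b := 2) (c := 4) (d := 5)
    (by decide) (by decide) (by decide) (by decide) (by decide) (by decide)
    {0, 2, 4, 5} (by ext; simp)
  have q0345 := diamond_pfv hT (a := 0) (b := 3) (c := 4) (d := 5)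
    (by decide) (by decide) (by decide) (by decide) (by decide) (by decide)
    {0, 3, 4, 5} (by ext; simp)
  have q1234 := diamond_pfv hT (a := 1) (b := 2) (c := 3) (d := 4)
    (by decide) (by decide) (by decide) (by decide) (by decide) (by decide)
    {1, 2, 3, 4} (by ext; simp)
  have q1235 := diamond_pfv hT (a := 1) (b := 2) (c := 3) (d := 5)
    (by decide) (by decide) (by decide) (by decide) (by decide) (by decide)
    {1, 2, 3, 5} (by ext; simp)
  have q1245 := diamond_pfv hT (a := 1) (b := 2) (c := 4) (d := 5)
    (by decide) (by decide) (by decide) (by decide) (by decide) (by decide)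
    {1, 2, 4, 5} (by ext; simp)
  have q1345 := diamond_pfv hT (a := 1) (b := 3) (c := 4) (d := 5)
    (by decide) (by decide) (by decide) (by decide) (by decide) (by decide)
    {1, 3, 4, 5} (by ext; simp)
  have q2345 := diamond_pfv hT (a := 2) (b := 3) (c := 4) (d := 5)
    (by decide) (by decide) (by decide) (by decide) (by decide) (by decide)
    {2, 3, 4, 5} (by ext; simp)
  simp only [pfv] at q0123 q0124 q0125 q0134 q0135 q0145 q0234 q0235 q0245 q0345 q1234 q1235 q1245 q1345 q2345
  rw [Finset.sum_insert (by decide)]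
  rw [Finset.sum_insert (by decide)]
  rw [Finset.sum_insert (by decide)]
  rw [Finset.sum_insert (by decide)]
  rw [Finset.sum_insert (by decide)]
  rw [Finset.sum_insert (by decide)]
  rw [Finset.sum_insert (by decide)]
  rw [Finset.sum_insert (by decide)]
  rw [Finset.sum_insert (by decide)]
  rw [Finset.sum_insert (by decide)]
  rw [Finset.sum_insert (by decide)]
  rw [Finset.sum_insert (by decide)]
  rw [Finset.sum_insert (by decide)]
  rw [Finset.sum_insert (by decide)]
  rw [Finset.sum_singleton]
  unfold minorSum
  linarith

theorem tdet_fin {r : Fin 6 → Fin 6 → Prop} (hT : IsTournament r) :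
    tdet r = pfSix (skew r 0 1) (skew r 0 2) (skew r 0 3) (skew r 0 4) (skew r 0 5) (skew r 1 2) (skew r 1 3) (skew r 1 4) (skew r 1 5) (skew r 2 3) (skew r 2 4) (skew r 2 5) (skew r 3 4) (skew r 3 5) (skew r 4 5) ^ 2 := by
  rw [← det_eq_pfSix]
  unfold tdet
  congr 1
  ext i j
  fin_cases i <;> fin_cases j <;>
    first
    | rfl
    | exact skew_self hT _
    | exact skew_swap hT _ _

theorem main_fin {r : Fin 6 → Fin 6 → Prop} (hT : IsTournament r) :
    Good (8 * (numDiamonds r : ℤ) + 15) (tdet r) := by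
  rw [numDiamonds_fin hT, tdet_fin hT]
  exact good_all _ _ _ _ _ _ _ _ _ _ _ _ _ _ _
    (skew_pm hT (by decide))
    (skew_pm hT (by decide))
    (skew_pm hT (by decide))
    (skew_pm hT (by decide))
    (skew_pm hT (by decide))
    (skew_pm hT (by decide))
    (skew_pm hT (by decide))
    (skew_pm hT (by decide))
    (skew_pm hT (by decide))
    (skew_pm hT (by decide))
    (skew_pm hT (by decide))
    (skew_pm hT (by decide))
    (skew_pm hT (by decide))
    (skew_pm hT (by decide))
    (skew_pm hT (by decide))

theorem isDiamond_map {V W : Type*} (e : W ≃ V) (r : V → V → Prop) (X : Finset W) :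
    IsDiamond (fun i j => r (e i) (e j)) X ↔ IsDiamond r (X.map e.toEmbedding) := by
  constructor
  · rintro ⟨a, b, c, d, rfl, h1, h2, h3, h4, h5, h6, h⟩
    exact ⟨e a, e b, e c, e d, by simp, by simpa, by simpa, by simpa, by simpa, by simpa,
      by simpa, h⟩
  · rintro ⟨a, b, c, d, hX, h1, h2, h3, h4, h5, h6, h⟩
    refine ⟨e.symm a, e.symm b, e.symm c, e.symm d, ?_, by simpa, by simpa, by simpa, by simpa,
      by simpa, by simpa, by simpa using h⟩
    apply Finset.map_injective e.toEmbedding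
    rw [hX]
    simp

theorem numDiamonds_equiv {V W : Type*} [Fintype V] [Fintype W] (e : W ≃ V)
    (r : V → V → Prop) : numDiamonds (fun i j => r (e i) (e j)) = numDiamonds r := by
  unfold numDiamonds
  rw [← Set.ncard_image_of_injective _ (Finset.map_injective e.toEmbedding)]
  congr 1
  ext X
  simp only [Set.mem_image, Set.mem_ofPred_eq, isDiamond_map]
  constructor
  · rintro ⟨Y, hY, rfl⟩
    exact hY
  · intro h
    have hX : (X.map e.symm.toEmbedding).map e.toEmbedding = X := by
      ext x; simp
    exact ⟨X.map e.symm.toEmbedding, by rwa [hX], hX⟩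

theorem tdet_equiv {V W : Type*} [Fintype V] [Fintype W] [DecidableEq V] [DecidableEq W]
    (e : W ≃ V) (r : V → V → Prop) : tdet (fun i j => r (e i) (e j)) = tdet r := by
  unfold tdet
  rw [← Matrix.det_submatrix_equiv_self e (skew r)]
  rfl

theorem stmt11 {V : Type*} [Fintype V] [DecidableEq V] (r : V → V → Prop)
    (hT : IsTournament r) (hcard : Fintype.card V = 6) :
    (numDiamonds r = 0 → tdet r = 1) ∧
    (numDiamonds r = 3 ∨ numDiamonds r = 4 → tdet r = 1 ∨ tdet r = 9) ∧
    (numDiamonds r = 5 → tdet r = 25) ∧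
    (numDiamonds r = 6 → tdet r = 49 ∨ tdet r = 81) := by 
  have e : Fin 6 ≃ V := (Fintype.equivFinOfCardEq hcard).symm
  have hT' : IsTournament (fun i j => r (e i) (e j)) :=
    ⟨fun i => hT.1 _, fun i j h => hT.2 _ _ (by simpa using h)⟩
  have key := main_fin hT'
  rw [numDiamonds_equiv, tdet_equiv] at key
  obtain ⟨k1, k2, k3, k4⟩ := key
  exact ⟨fun h => k1 (by omega), fun h => k2 (by omega), fun h => k3 (by omega),
    fun h => k4 (by omega)⟩
end

section
/- A tournament T belongs to D_5 \ D_3 if and only if T is switching equivalent to a transitive blowup of L_6. -/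
open scoped Classical

theorem det4_skew (M : Fin 4 → Fin 4 → ℤ) (h : ∀ i j, M j i = - M i j) :
    (Matrix.of M).det = (M 0 1 * M 2 3 - M 0 2 * M 1 3 + M 0 3 * M 1 2) ^ 2 := by
  have hd : ∀ i, M i i = 0 := fun i => by have := h i i; omega
  have h10 := h 0 1; have h20 := h 0 2; have h30 := h 0 3; have h21 := h 1 2
  have h31 := h 1 3; have h32 := h 2 3
  simp [Matrix.det_succ_row_zero, Fin.sum_univ_succ, hd, h10, h20, h30, h21, h31, h32, Fin.succAbove]
  ring

def pf6 (M : Fin 6 → Fin 6 → ℤ) : ℤ :=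
  M 0 1 * (M 2 3 * M 4 5 - M 2 4 * M 3 5 + M 2 5 * M 3 4)
  - M 0 2 * (M 1 3 * M 4 5 - M 1 4 * M 3 5 + M 1 5 * M 3 4)
  + M 0 3 * (M 1 2 * M 4 5 - M 1 4 * M 2 5 + M 1 5 * M 2 4)
  - M 0 4 * (M 1 2 * M 3 5 - M 1 3 * M 2 5 + M 1 5 * M 2 3)
  + M 0 5 * (M 1 2 * M 3 4 - M 1 3 * M 2 4 + M 1 4 * M 2 3)

set_option maxHeartbeats 4000000 in
theorem det6_aux (a b c d e f g h i j k l m n o : ℤ) :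
    (!![0,a,b,c,d,e; -a,0,f,g,h,i; -b,-f,0,j,k,l; -c,-g,-j,0,m,n; -d,-h,-k,-m,0,o; -e,-i,-l,-n,-o,0] : Matrix (Fin 6) (Fin 6) ℤ).det
     = (a*(j*o-k*n+l*m) - b*(g*o-h*n+i*m)+c*(f*o-h*l+i*k)-d*(f*n-g*l+i*j)+e*(f*m-g*k+h*j))^2 := by
  simp [Matrix.det_succ_row_zero, Fin.sum_univ_succ, Fin.succAbove]
  ring

theorem det6_skew (M : Fin 6 → Fin 6 → ℤ) (h : ∀ i j, M j i = - M i j) :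
    (Matrix.of M).det = pf6 M ^ 2 := by
  have hd : ∀ i, M i i = 0 := fun i => by have := h i i; omega
  have e : Matrix.of M = !![0,M 0 1,M 0 2,M 0 3,M 0 4,M 0 5; -M 0 1,0,M 1 2,M 1 3,M 1 4,M 1 5; -M 0 2,-M 1 2,0,M 2 3,M 2 4,M 2 5; -M 0 3,-M 1 3,-M 2 3,0,M 3 4,M 3 5; -M 0 4,-M 1 4,-M 2 4,-M 3 4,0,M 4 5; -M 0 5,-M 1 5,-M 2 5,-M 3 5,-M 4 5,0] := by
    ext i j
    fin_cases i <;> fin_cases j <;> simp [hd] <;> exact h _ _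
  rw [e, det6_aux]; rfl

theorem det_schur {τ : Type*} [Fintype τ] [DecidableEq τ]
    (A : Fin 2 ⊕ τ → Fin 2 ⊕ τ → ℤ) (a : ℤ) (ha : a * a = 1)
    (h00 : A (.inl 0) (.inl 0) = 0) (h11 : A (.inl 1) (.inl 1) = 0)
    (h01 : A (.inl 0) (.inl 1) = a) (h10 : A (.inl 1) (.inl 0) = -a) :
    (Matrix.of A).det = (Matrix.of fun i j : τ => A (.inr i) (.inr j)
      + a * (A (.inr i) (.inl 0) * A (.inl 1) (.inr j)
        - A (.inr i) (.inl 1) * A (.inl 0) (.inr j))).det := by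
  have e := Matrix.fromBlocks_toBlocks (Matrix.of A)
  have eA : (Matrix.of A).toBlocks₁₁ = !![0, a; -a, 0] := by
    ext i j; fin_cases i <;> fin_cases j <;> simp [Matrix.toBlocks₁₁, *]
  rw [eA] at e
  let iv : Invertible (!![0, a; -a, 0] : Matrix (Fin 2) (Fin 2) ℤ) :=
    ⟨!![0, -a; a, 0], by ext i j; fin_cases i <;> fin_cases j <;> simp [Matrix.mul_apply, ha],
     by ext i j; fin_cases i <;> fin_cases j <;> simp [Matrix.mul_apply, ha]⟩
  rw [← e, Matrix.det_fromBlocks₁₁]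
  have : (!![0, a; -a, 0] : Matrix (Fin 2) (Fin 2) ℤ).det = 1 := by simp [Matrix.det_fin_two, ha]
  rw [this, one_mul]
  congr 1
  ext i j
  have e2 : ⅟(!![0, a; -a, 0] : Matrix (Fin 2) (Fin 2) ℤ) = !![0, -a; a, 0] := rfl
  rw [e2]
  simp [Matrix.mul_apply, Matrix.toBlocks₂₂, Matrix.toBlocks₂₁, Matrix.toBlocks₁₂, Fin.sum_univ_two]
  ring

def zz (b : Bool) : ℤ := cond b 1 (-1)

def B6 : Fin 6 → Fin 6 → ℤ := ![![0,1,1,1,1,-1], ![-1,0,1,1,1,1], ![-1,-1,0,1,1,-1],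
  ![-1,-1,-1,0,1,1], ![-1,-1,-1,-1,0,-1], ![1,-1,1,-1,1,0]]

def B4 : Fin 4 → Fin 4 → ℤ := ![![0,1,1,1], ![-1,0,1,-1], ![-1,-1,0,1], ![-1,1,-1,0]]

/-- Extend a matrix by one more vertex `v`, where `p j` is the entry at `(v, j)`. -/
def extM {n : ℕ} (B : Fin n → Fin n → ℤ) (p : Fin n → ℤ) : Fin (n+1) → Fin (n+1) → ℤ :=
  fun a b => if ha : a.val < n then (if hb : b.val < n then B ⟨a, ha⟩ ⟨b, hb⟩ else - p ⟨a, ha⟩)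
    else (if hb : b.val < n then p ⟨b, hb⟩ else 0)

def snocF {α : Type*} {n : ℕ} (p : Fin n → α) (v : α) : Fin (n+1) → α :=
  fun a => if h : a.val < n then p ⟨a, h⟩ else v

def rowM {n : ℕ} (B : Fin n → Fin n → ℤ) (i : Fin n) (o : Bool) : Fin n → ℤ :=
  fun k => if k = i then zz o else B i k

def ext2 {n : ℕ} (B : Fin n → Fin n → ℤ) (i : Fin n) (o : Bool) (j : Fin n) (q : Bool) (a : ℤ) :
    Fin (n+2) → Fin (n+2) → ℤ :=
  extM (extM B (rowM B i o)) (snocF (rowM B j q) a)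

def big6 (K : Fin 6 → Fin 6 → ℤ) : Prop := 25 < pf6 K * pf6 K

instance (K) : Decidable (big6 K) := by unfold big6; infer_instance

def schur6 (K : Fin 8 → Fin 8 → ℤ) : Fin 6 → Fin 6 → ℤ := fun i j =>
  K (i.natAdd 2) (j.natAdd 2) + K 0 1 * (K (i.natAdd 2) 0 * K 1 (j.natAdd 2)
    - K (i.natAdd 2) 1 * K 0 (j.natAdd 2))

def bad7 (K : Fin 7 → Fin 7 → ℤ) : Prop :=
  ∃ k : Fin 7, big6 (fun a b => K (k.succAbove a) (k.succAbove b))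

instance (K) : Decidable (bad7 K) := by unfold bad7; infer_instance

def bad8 (K : Fin 8 → Fin 8 → ℤ) : Prop :=
  (∃ k, bad7 (fun a b => K (Fin.succAbove k a) (k.succAbove b))) ∨
   (K 0 1 * K 0 1 = 1 ∧ big6 (schur6 K))

instance (K) : Decidable (bad8 K) := by unfold bad8; infer_instance

def sgnH (K : Fin 6 → Fin 6 → ℤ) (h : Fin 6 → Fin 6) : Fin 6 → ℤ :=
  fun a => if a = 0 then 1 else K (h 0) (h a) * B6 0 a

def isoL (K : Fin 6 → Fin 6 → ℤ) (h : Fin 6 → Fin 6) : Prop :=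
  (∀ a, sgnH K h a = 1 ∨ sgnH K h a = -1) ∧
  ∀ a b, sgnH K h a * sgnH K h b * K (h a) (h b) = B6 a b

instance (K h) : Decidable (isoL K h) := by unfold isoL; infer_instance

def perms : List (Fin 6 → Fin 6) := [![0, 1, 2, 4, 5, 3], ![0, 1, 2, 5, 4, 3], ![0, 1, 4, 5, 2, 3],
  ![0, 1, 5, 4, 2, 3], ![0, 2, 3, 4, 5, 1], ![0, 2, 3, 5, 4, 1], ![0, 2, 4, 5, 3, 1],
  ![0, 2, 5, 4, 3, 1], ![0, 3, 1, 4, 5, 2], ![0, 3, 1, 5, 4, 2], ![0, 3, 4, 5, 1, 2],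
  ![0, 3, 5, 4, 1, 2], ![0, 4, 5, 1, 2, 3], ![0, 4, 5, 2, 3, 1], ![0, 4, 5, 3, 1, 2],
  ![0, 5, 4, 1, 2, 3], ![0, 5, 4, 2, 3, 1], ![0, 5, 4, 3, 1, 2], ![1, 3, 2, 4, 5, 0],
  ![1, 3, 2, 5, 4, 0], ![1, 3, 4, 5, 2, 0], ![1, 3, 5, 4, 2, 0], ![1, 4, 5, 3, 2, 0],
  ![1, 5, 4, 3, 2, 0]]

def pat (a b c d e f : Bool) : Fin 6 → ℤ := ![zz a, zz b, zz c, zz d, zz e, zz f]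

def twinPat {n : ℕ} (B : Fin n → Fin n → ℤ) (p : Fin n → ℤ) : Prop :=
  ∃ i, ∃ s : Bool, ∀ j, j ≠ i → p j = zz s * B i j

instance {n : ℕ} (B : Fin n → Fin n → ℤ) (p : Fin n → ℤ) : Decidable (twinPat B p) := by
  unfold twinPat; infer_instance

set_option maxRecDepth 100000 in
theorem chk4a : ∀ a b c d : Bool, twinPat B4 ![zz a, zz b, zz c, zz d] := by decide +kernel

set_option maxRecDepth 100000 in
theorem chk4b : ∀ i o j q, i ≠ j → big6 (ext2 B4 i o j q (B4 i j)) ∨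
    ∃ h ∈ perms, isoL (ext2 B4 i o j q (B4 i j)) h := by decide +kernel

theorem chk4c : ∀ i, big6 (ext2 B4 i false i true (-1)) := by decide +kernel

theorem chk6a : ∀ a b c d e f : Bool, twinPat B6 (pat a b c d e f) ∨
    bad7 (extM B6 (pat a b c d e f)) := by decide +kernel

theorem chk6b : ∀ i o j q, i ≠ j → bad8 (ext2 B6 i o j q (B6 i j)) := by decide +kernel

theorem chk6c : ∀ i, bad8 (ext2 B6 i false i true (-1)) := by decide +kernel

theorem B6_skew : ∀ i j, B6 j i = - B6 i j := by decide +kernel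
theorem B4_skew : ∀ i j, B4 j i = - B4 i j := by decide +kernel
theorem B6_ne : ∀ i j, i ≠ j → B6 i j * B6 i j = 1 := by decide +kernel
theorem B4_ne : ∀ i j, i ≠ j → B4 i j * B4 i j = 1 := by decide +kernel
theorem pf6_B6 : pf6 B6 ^ 2 = 25 := by decide +kernel

section structural
variable {V : Type*}

def TM (M : V → V → ℤ) : Prop :=
  (∀ x y, M y x = - M x y) ∧ ∀ x y, x ≠ y → M x y = 1 ∨ M x y = -1

def D5 (M : V → V → ℤ) : Prop :=
  ∀ (n : ℕ) (f : Fin n → V), (Matrix.of fun i j => M (f i) (f j)).det ≤ 25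

def IsSgn {W : Type*} (σ : W → ℤ) : Prop := ∀ x, σ x = 1 ∨ σ x = -1

def sw (σ : V → ℤ) (M : V → V → ℤ) : V → V → ℤ := fun x y => σ x * σ y * M x y

def NotEmb {n : ℕ} (M : V → V → ℤ) (K : Fin n → Fin n → ℤ) : Prop :=
  ∀ (τ : Fin n → ℤ), IsSgn τ → ∀ g : Fin n → V, ¬ ∀ a b, τ a * τ b * M (g a) (g b) = K a b

def Blow {n : ℕ} (M : V → V → ℤ) (B : Fin n → Fin n → ℤ) (c : V → Fin n) (σ : V → ℤ) : Prop :=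
  IsSgn σ ∧ (∀ x y, c x ≠ c y → sw σ M x y = B (c x) (c y)) ∧
  ∀ x y z, c x = c y → c y = c z → ¬ (sw σ M x y = 1 ∧ sw σ M y z = 1 ∧ sw σ M z x = 1)

theorem sgn_sq {W : Type*} {σ : W → ℤ} (h : IsSgn σ) (x : W) : σ x * σ x = 1 := by
  rcases h x with h | h <;> rw [h] <;> rfl

theorem TM.sw {M : V → V → ℤ} (hM : TM M) {σ : V → ℤ} (hσ : IsSgn σ) : TM (sw σ M) := by
  refine ⟨fun x y => ?_, fun x y hxy => ?_⟩
  · simp only [_root_.sw]; rw [hM.1 x y]; ring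
  · simp only [_root_.sw]
    rcases hσ x with h | h <;> rcases hσ y with h' | h' <;> rcases hM.2 x y hxy with h2 | h2 <;>
      simp [h, h', h2]

theorem det_sgn {τ : Type*} [Fintype τ] [DecidableEq τ] (σ : τ → ℤ) (hσ : IsSgn σ)
    (A : τ → τ → ℤ) :
    (Matrix.of fun i j => σ i * σ j * A i j).det = (Matrix.of A).det := by
  have : (Matrix.of fun i j => σ i * σ j * A i j)
      = Matrix.of fun i j => σ i * (Matrix.of fun i j => σ j * (Matrix.of A) i j) i j := by
    ext i j; simp [mul_assoc]
  rw [this, Matrix.det_mul_column, Matrix.det_mul_row, ← mul_assoc, ← Finset.prod_mul_distrib]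
  rw [Finset.prod_congr rfl (fun x _ => sgn_sq hσ x)]
  simp

theorem NotEmb.sw {n : ℕ} {M : V → V → ℤ} {K : Fin n → Fin n → ℤ} (h : NotEmb M K) {σ : V → ℤ}
    (hσ : IsSgn σ) : NotEmb (sw σ M) K := by
  intro τ hτ g hg
  refine h (fun a => τ a * σ (g a)) (fun a => ?_) g (fun a b => ?_)
  · rcases hτ a with h | h <;> rcases hσ (g a) with h' | h' <;> simp [h, h']
  · rw [← hg a b]; simp only [_root_.sw]; ring

theorem notEmb_det {n : ℕ} {M : V → V → ℤ} (hD : D5 M) {K : Fin n → Fin n → ℤ}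
    (h : 25 < (Matrix.of K).det) : NotEmb M K := by
  intro τ hτ g hg
  have := hD n g
  rw [← det_sgn τ hτ] at this
  simp only [hg] at this
  exact absurd h (not_lt.mpr this)

theorem emb_skew {n : ℕ} {M : V → V → ℤ} (hM : TM M) {K : Fin n → Fin n → ℤ} {τ : Fin n → ℤ}
    {g : Fin n → V} (hg : ∀ a b, τ a * τ b * M (g a) (g b) = K a b) (i j) : K j i = - K i j := by
  rw [← hg, ← hg, hM.1 (g i) (g j)]; ring

theorem notEmb_comp {n m : ℕ} {M : V → V → ℤ} {K : Fin n → Fin n → ℤ} (h : Fin m → Fin n)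
    (hK : NotEmb M (fun a b => K (h a) (h b))) : NotEmb M K := by
  intro τ hτ g hg
  exact hK (fun a => τ (h a)) (fun a => hτ _) (fun a => g (h a)) (fun a b => hg _ _)

theorem notEmb_big6 {M : V → V → ℤ} (hM : TM M) (hD : D5 M) {K : Fin 6 → Fin 6 → ℤ}
    (h : big6 K) : NotEmb M K := by
  intro τ hτ g hg
  refine notEmb_det hD ?_ τ hτ g hg
  rw [det6_skew K (emb_skew hM hg), sq]; exact h

theorem notEmb_bad7 {M : V → V → ℤ} (hM : TM M) (hD : D5 M) {K : Fin 7 → Fin 7 → ℤ}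
    (h : bad7 K) : NotEmb M K := by
  obtain ⟨k, hk⟩ := h
  exact notEmb_comp k.succAbove (notEmb_big6 hM hD hk)

theorem notEmb_bad8 {M : V → V → ℤ} (hM : TM M) (hD : D5 M) {K : Fin 8 → Fin 8 → ℤ}
    (h : bad8 K) : NotEmb M K := by
  rcases h with ⟨k, hk⟩ | ⟨h1, h2⟩
  · exact notEmb_comp k.succAbove (notEmb_bad7 hM hD hk)
  · intro τ hτ g hg
    have hs := emb_skew hM hg
    refine notEmb_det hD ?_ τ hτ g hg
    have hd : ∀ i, K i i = 0 := fun i => by have := hs i i; omega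
    let e : Fin 2 ⊕ Fin 6 ≃ Fin 8 := finSumFinEquiv
    have e1 := Matrix.det_submatrix_equiv_self e (Matrix.of K)
    rw [← e1]
    have e2 := det_schur (fun a b => K (e a) (e b)) (K 0 1) h1 (hd _) (hd _) rfl (hs 0 1)
    have e3 : (Matrix.of K).submatrix e e = Matrix.of (fun a b => K (e a) (e b)) := rfl
    rw [e3, e2]
    have e4 : (Matrix.of (schur6 K)).det = pf6 (schur6 K) ^ 2 := by
      apply det6_skew
      intro i j
      simp only [schur6]
      rw [hs (i.natAdd 2) (j.natAdd 2), hs 0 (i.natAdd 2), hs 0 (j.natAdd 2),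
        hs 1 (i.natAdd 2), hs 1 (j.natAdd 2)]
      ring
    have h3 : 25 < pf6 (schur6 K) ^ 2 := by rw [sq]; exact h2
    rw [← e4] at h3
    exact h3

theorem emb_ext {n : ℕ} {N : V → V → ℤ} (hN : TM N) {B : Fin n → Fin n → ℤ} {p : Fin n → ℤ}
    {g : Fin n → V} {v : V} (h : ∀ a b, N (g a) (g b) = B a b) (hp : ∀ b, N v (g b) = p b)
    (a b) : N (snocF g v a) (snocF g v b) = extM B p a b := by
  unfold snocF extM
  split_ifs
  · exact h _ _
  · rw [hN.1, hp]
  · exact hp _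
  · have := hN.1 v v; omega

theorem emb_snoc {n : ℕ} {N : V → V → ℤ} {p : Fin n → ℤ} {a : ℤ} {w : V}
    {g : Fin n → V} {v : V} (hp : ∀ b, N w (g b) = p b) (h : N w v = a)
    (b) : N w (snocF g v b) = snocF p a b := by
  unfold snocF
  split_ifs
  · exact hp _
  · exact h

theorem notEmb_one {n : ℕ} {M : V → V → ℤ} {K : Fin n → Fin n → ℤ} (h : NotEmb M K)
    (g : Fin n → V) (hg : ∀ a b, M (g a) (g b) = K a b) : False :=
  h (fun _ => 1) (fun _ => Or.inl rfl) g (by simpa using hg)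

theorem structure_lemma {n : ℕ} (B : Fin n → Fin n → ℤ) (hBs : ∀ i j, B j i = - B i j)
    (hBn : ∀ i j, i ≠ j → B i j * B i j = 1) (hn : 2 ≤ n) (M : V → V → ℤ) (hM : TM M)
    (f : Fin n → V) (hf : ∀ a b, M (f a) (f b) = B a b)
    (h1 : ∀ v, (∀ i, v ≠ f i) → twinPat B (fun j => M v (f j)))
    (h2 : ∀ i o j q, i ≠ j → NotEmb M (ext2 B i o j q (B i j)))
    (h3 : ∀ i, NotEmb M (ext2 B i false i true (-1))) :
    ∃ c σ, Blow M B c σ ∧ ∀ i, ∃ v, c v = i := by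
  have h1' : ∀ v, twinPat B (fun j => M v (f j)) := by
    intro v
    by_cases hv : ∀ i, v ≠ f i
    · exact h1 v hv
    · push Not at hv
      obtain ⟨i, rfl⟩ := hv
      exact ⟨i, true, fun j _ => by simp [hf, zz]⟩
  choose c s hs using h1'
  have hs : ∀ v j, j ≠ c v → M v (f j) = zz (s v) * B (c v) j := hs
  have hB0 : ∀ i, B i i = 0 := fun i => by have := hBs i i; omega
  have hcf : ∀ i, c (f i) = i := by
    intro i
    by_contra hne
    have h := hs (f i) i (Ne.symm hne)
    rw [hf, hB0] at h
    have h' := hBn _ _ hne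
    have h2 : B (c (f i)) i = 0 := by
      cases hsi : s (f i) <;> simp only [hsi, zz, cond] at h <;> omega
    simp [h2] at h'
  have hsf : ∀ i, s (f i) = true := by
    intro i
    have : ∃ j, j ≠ i := by
      have : Nontrivial (Fin n) := Fin.nontrivial_iff_two_le.mpr hn
      exact exists_ne i
    obtain ⟨j, hj⟩ := this
    have h := hs (f i) j (by rw [hcf]; exact hj)
    rw [hcf, hf] at h
    have h' := hBn i j hj.symm
    cases hsi : s (f i)
    · simp [hsi, zz] at h
      have : B i j = 0 := by omega
      simp [this] at h'
    · rfl
  let σ : V → ℤ := fun v => zz (s v)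
  have hσ : IsSgn σ := fun v => by
    show zz (s v) = 1 ∨ zz (s v) = -1
    cases s v <;> simp [zz]
  have hσf : ∀ i, σ (f i) = 1 := fun i => by show zz (s (f i)) = 1; rw [hsf]; rfl
  have hN := hM.sw hσ
  have hNs : ∀ v j, j ≠ c v → sw σ M v (f j) = B (c v) j := by
    intro v j hj
    have := hs v j hj
    simp only [sw, hσf, mul_one]
    rw [this, ← mul_assoc]
    show σ v * σ v * _ = _
    rw [sgn_sq hσ, one_mul]
  have hNf : ∀ a b, sw σ M (f a) (f b) = B a b := by
    intro a b; simp [sw, hσf, hf]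
  refine ⟨c, σ, ⟨hσ, ?_, ?_⟩, fun i => ⟨f i, hcf i⟩⟩
  · intro v w hvw
    by_cases hw : ∃ j, w = f j
    · obtain ⟨j, rfl⟩ := hw
      rw [hcf] at hvw ⊢
      exact hNs v j hvw.symm
    by_cases hv : ∃ j, v = f j
    · obtain ⟨j, rfl⟩ := hv
      rw [hcf] at hvw ⊢
      rw [hN.1, hNs w j hvw, ← hBs]
    have hvw' : v ≠ w := fun h => hvw (by rw [h])
    by_contra hcon
    have hwv : sw σ M w v = B (c v) (c w) := by
      rw [hN.1 v w]
      have e1 := hBn _ _ hvw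
      have e2 := mul_self_eq_one_iff.mp e1
      have e3 := hN.2 v w hvw'
      omega
    have hrow : ∀ u, (¬ ∃ j, u = f j) →
        ∀ b, sw σ M u (f b) = rowM B (c u) (decide (sw σ M u (f (c u)) = 1)) b := by
      intro u hu b
      unfold rowM
      split_ifs with hb
      · subst hb
        rcases hN.2 u (f (c u)) (fun h => hu ⟨_, h⟩) with h | h <;> simp [h, zz]
      · exact hNs u b hb
    refine notEmb_one ((h2 (c v) (decide (sw σ M v (f (c v)) = 1)) (c w)
      (decide (sw σ M w (f (c w)) = 1)) hvw).sw hσ) (snocF (snocF f v) w) ?_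
    exact emb_ext hN (emb_ext hN hNf (hrow v hv)) (emb_snoc (hrow w hw) hwv)
  · intro x y z hxy hyz ⟨hx, hy, hz⟩
    refine notEmb_one ((h3 (c x)).sw hσ) (snocF (snocF (Function.update f (c x) x) y) z) ?_
    have hup : ∀ u, c u = c x → ∀ b, b ≠ c x →
        sw σ M u (Function.update f (c x) x b) = B (c x) b := by
      intro u hu b hb
      rw [Function.update_of_ne hb, hNs u b (by rw [hu]; exact hb), hu]
    have h0 : ∀ u, sw σ M u u = 0 := fun u => by have := hN.1 u u; omega
    refine emb_ext hN (emb_ext hN ?_ ?_) (emb_snoc ?_ ?_)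
    · intro a b
      by_cases ha : a = c x
      · by_cases hb : b = c x
        · rw [ha, hb]; simp [h0, hB0]
        · rw [ha, Function.update_self, hup x rfl b hb]
      · by_cases hb : b = c x
        · rw [hb, hN.1, Function.update_self, hup x rfl a ha, ← hBs]
        · rw [Function.update_of_ne ha, Function.update_of_ne hb, hNf]
    · intro b
      unfold rowM
      split_ifs with hb
      · rw [hb, Function.update_self, hN.1 x y, hx]; rfl
      · exact hup y hxy.symm b hb
    · intro b
      unfold rowM
      split_ifs with hb
      · rw [hb, Function.update_self, hz]; rfl
      · exact hup z (by rw [hxy, hyz]) b hb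
    · rw [hN.1 y z, hy]

end structural

section reduction
variable {V : Type*}

noncomputable def dt (M : V → V → ℤ) (s : Finset V) : ℤ :=
  (Matrix.of fun i j : {x // x ∈ s} => M i.1 j.1).det

theorem dt_twin {N : V → V → ℤ} (hN : TM N) (s : Finset V) (x y : V) (hx : x ∈ s) (hy : y ∈ s)
    (hxy : x ≠ y) (h : ∀ z ∈ s, z ≠ x → z ≠ y → N x z = N y z) :
    dt N s = dt N (s \ {x, y}) := by
  let φ : Fin 2 ⊕ {z // z ∈ s \ {x, y}} → {z // z ∈ s} :=
    Sum.elim ![⟨x, hx⟩, ⟨y, hy⟩] (fun z => ⟨z.1, (Finset.mem_sdiff.mp z.2).1⟩)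
  have hφ : Function.Bijective φ := by
    constructor
    · intro a b hab
      rcases a with a | ⟨a, ha⟩ <;> rcases b with b | ⟨b, hb⟩
      · fin_cases a <;> fin_cases b <;> simp [φ, hxy, hxy.symm] at hab ⊢
      · simp at hb
        fin_cases a <;> simp [φ] at hab <;> subst hab <;> simp at hb
      · simp at ha
        fin_cases b <;> simp [φ] at hab <;> subst hab <;> simp at ha
      · simp [φ] at hab; subst hab; rfl
    · rintro ⟨z, hz⟩
      by_cases h1 : z = x
      · subst h1; exact ⟨.inl 0, rfl⟩
      by_cases h2 : z = y
      · subst h2; exact ⟨.inl 1, rfl⟩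
      exact ⟨.inr ⟨z, by simp [hz, h1, h2]⟩, rfl⟩
  have h0 : ∀ u, N u u = 0 := fun u => by have := hN.1 u u; omega
  unfold dt
  rw [← Matrix.det_submatrix_equiv_self (Equiv.ofBijective φ hφ)]
  have ha : N x y * N x y = 1 := by rcases hN.2 x y hxy with h | h <;> rw [h] <;> rfl
  refine (det_schur (fun a b => N (φ a).1 (φ b).1) (N x y) ha (h0 _) (h0 _) rfl (hN.1 x y)).trans ?_
  congr 1
  ext ⟨i, hi⟩ ⟨j, hj⟩
  simp at hi hj
  show N i j + N x y * (N i x * N y j - N i y * N x j) = N i j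
  rw [h j hj.1 hj.2.1 hj.2.2, hN.1 x i, hN.1 y i, h i hi.1 hi.2.1 hi.2.2]
  ring

theorem reduce {ι : Type*} {N : V → V → ℤ} (hN : TM N) (c : V → ι)
    (hB : ∀ x y z, c x = c y → c x ≠ c z → N x z = N y z)
    (hC : ∀ x y z, c x = c y → c y = c z → ¬ (N x y = 1 ∧ N y z = 1 ∧ N z x = 1)) :
    ∀ (k : ℕ) (s : Finset V), s.card ≤ k → ∃ t : Finset V, Set.InjOn c t ∧ dt N s = dt N t := by
  intro k
  induction k with
  | zero =>
    intro s hs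
    refine ⟨s, ?_, rfl⟩
    have : s = ∅ := by simpa using hs
    subst this; simp
  | succ k ih =>
    intro s hs
    by_cases hinj : Set.InjOn c s
    · exact ⟨s, hinj, rfl⟩
    have h0 : ∀ u, N u u = 0 := fun u => by have := hN.1 u u; omega
    let P : Finset (V × V) := (s ×ˢ s).filter (fun p => c p.1 = c p.2 ∧ N p.1 p.2 = 1)
    have hP : P.Nonempty := by
      unfold Set.InjOn at hinj
      push Not at hinj
      obtain ⟨x, hx, y, hy, hc, hne⟩ := hinj
      rcases hN.2 x y hne with h | h
      · exact ⟨(x, y), by simp [P, hc, h]; exact ⟨hx, hy⟩⟩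
      · exact ⟨(y, x), by simp [P, hc, hN.1 x y, h]; exact ⟨hy, hx⟩⟩
    obtain ⟨⟨x, y⟩, hp, hmin⟩ := Finset.exists_min_image P
      (fun p => (s.filter (fun z => c z = c p.1 ∧ N p.1 z = 1 ∧ N z p.2 = 1)).card) hP
    simp [P] at hp
    obtain ⟨⟨hx, hy⟩, hc, hxy1⟩ := hp
    have hxy : x ≠ y := fun h => by rw [h, h0] at hxy1; omega
    have hno : ∀ z ∈ s, c z = c x → N x z = 1 → N z y = 1 → False := by
      intro z hz hcz h1 h2
      have := hmin (x, z) (by simp [P, hx, hz, hcz, h1])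
      refine absurd this (not_le.mpr (Finset.card_lt_card ?_))
      rw [Finset.ssubset_iff_of_subset]
      · refine ⟨z, by simp [hz, hcz, h1, h2], by simp [h0]⟩
      · intro w hw
        simp at hw ⊢
        obtain ⟨hw, hcw, h3, h4⟩ := hw
        refine ⟨hw, hcw, h3, ?_⟩
        have hwy : w ≠ y := by
          rintro rfl
          have := hN.1 w z; omega
        rcases hN.2 w y hwy with h | h
        · exact h
        · exact absurd ⟨h4, h2, by rw [hN.1, h]; rfl⟩ (hC w z y (by rw [hcw, hcz]) (by rw [hcz, hc]))
    have htw := dt_twin hN s x y hx hy hxy (by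
      intro z hz hzx hzy
      by_cases hcz : c x = c z
      · rcases hN.2 x z hzx.symm with h1 | h1 <;> rcases hN.2 y z hzy.symm with h2 | h2
        · rw [h1, h2]
        · exact (hno z hz hcz.symm h1 (by rw [hN.1, h2]; rfl)).elim
        · exact absurd ⟨hxy1, h2, by rw [hN.1, h1]; rfl⟩ (hC x y z hc (by rw [← hc, hcz]))
        · rw [h1, h2]
      · exact hB x y z hc hcz)
    have hcard : (s \ {x, y}).card ≤ k := by
      have : (s \ {x, y}).card < s.card := by
        apply Finset.card_lt_card
        rw [Finset.ssubset_iff_of_subset Finset.sdiff_subset]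
        exact ⟨x, hx, by simp⟩
      omega
    obtain ⟨t, ht, he⟩ := ih _ hcard
    exact ⟨t, ht, htw.trans he⟩

theorem det_le9 {n : ℕ} {N : Fin n → Fin n → ℤ} (hN : TM N) (hn : n ≤ 5) :
    (Matrix.of N).det ≤ 9 := by
  have hodd : Odd n → (Matrix.of N).det = 0 := by
    intro ho
    have h1 : (Matrix.of N).transpose = -(Matrix.of N) := by
      ext i j; exact hN.1 i j
    have h2 := congrArg Matrix.det h1
    rw [Matrix.det_transpose, Matrix.det_neg, Fintype.card_fin, ho.neg_one_pow] at h2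
    omega
  have h0 : ∀ u, N u u = 0 := fun u => by have := hN.1 u u; omega
  interval_cases n
  · simp
  · rw [hodd (by decide)]; norm_num
  · rw [Matrix.det_fin_two]
    have h1 : N 1 0 = - N 0 1 := hN.1 0 1
    rcases hN.2 0 1 (by decide) with h | h <;> simp [h0, h1, h]
  · rw [hodd (by decide)]; norm_num
  · rw [det4_skew N hN.1]
    rcases hN.2 0 1 (by decide) with h1 | h1 <;> rcases hN.2 2 3 (by decide) with h2 | h2 <;>
    rcases hN.2 0 2 (by decide) with h3 | h3 <;> rcases hN.2 1 3 (by decide) with h4 | h4 <;>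
    rcases hN.2 0 3 (by decide) with h5 | h5 <;> rcases hN.2 1 2 (by decide) with h6 | h6 <;>
    rw [h1, h2, h3, h4, h5, h6] <;> norm_num
  · rw [hodd (by decide)]; norm_num

theorem dt_le9 {N : V → V → ℤ} (hN : TM N) (t : Finset V) (ht : t.card ≤ 5) : dt N t ≤ 9 := by
  unfold dt
  rw [← Matrix.det_submatrix_equiv_self t.equivFin.symm]
  refine det_le9 (N := fun i j => N (t.equivFin.symm i).1 (t.equivFin.symm j).1) ⟨?_, ?_⟩ ht
  · intro x y; exact hN.1 _ _
  · intro x y hxy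
    apply hN.2
    intro h
    exact hxy (t.equivFin.symm.injective (Subtype.ext h))

theorem dt_sw (M : V → V → ℤ) {σ : V → ℤ} (hσ : IsSgn σ) (s : Finset V) :
    dt (sw σ M) s = dt M s :=
  det_sgn (fun x : {x // x ∈ s} => σ x.1) (fun x => hσ x.1) (fun i j => M i.1 j.1)

theorem blow_dt {n : ℕ} {M : V → V → ℤ} (hM : TM M) {B : Fin n → Fin n → ℤ} {c : V → Fin n}
    {σ : V → ℤ} (h : Blow M B c σ) (s : Finset V) :
    ∃ t : Finset V, Set.InjOn c t ∧ dt M s = dt (sw σ M) t := by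
  obtain ⟨t, ht, he⟩ := reduce (hM.sw h.1) c (by
    intro x y z hxy hxz
    rw [h.2.1 x z hxz, h.2.1 y z (by rw [← hxy]; exact hxz), hxy]) h.2.2 s.card s le_rfl
  exact ⟨t, ht, by rw [← he, dt_sw M h.1]⟩

theorem injOn_card {n : ℕ} {c : V → Fin n} {t : Finset V} (h : Set.InjOn c t) : t.card ≤ n := by
  rw [← Finset.card_image_of_injOn h]
  simpa using Finset.card_le_univ (t.image c)

theorem blow_le9 {n : ℕ} (hn : n ≤ 5) {M : V → V → ℤ} (hM : TM M) {B : Fin n → Fin n → ℤ}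
    {c : V → Fin n} {σ : V → ℤ} (h : Blow M B c σ) (s : Finset V) : dt M s ≤ 9 := by
  obtain ⟨t, ht, he⟩ := blow_dt hM h s
  rw [he]
  exact dt_le9 (hM.sw h.1) t ((injOn_card ht).trans hn)

theorem det_B6 {N : V → V → ℤ} (f : Fin 6 → V) (hf : ∀ a b, N (f a) (f b) = B6 a b) :
    (Matrix.of fun i j => N (f i) (f j)).det = 25 := by
  have : (Matrix.of fun i j => N (f i) (f j)) = Matrix.of B6 := by ext i j; exact hf i j
  rw [this, det6_skew B6 B6_skew, pf6_B6]

theorem blow_le25 {M : V → V → ℤ} (hM : TM M)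
    {c : V → Fin 6} {σ : V → ℤ} (h : Blow M B6 c σ) (s : Finset V) : dt M s ≤ 25 := by
  obtain ⟨t, ht, he⟩ := blow_dt hM h s
  rw [he]
  by_cases h5 : t.card ≤ 5
  · exact (dt_le9 (hM.sw h.1) t h5).trans (by norm_num)
  have h6 : t.card = 6 := by have := injOn_card ht; omega
  have hbij : Function.Bijective (fun x : {x // x ∈ t} => c x.1) := by
    rw [Fintype.bijective_iff_injective_and_card]
    refine ⟨fun x y hxy => Subtype.ext (ht x.2 y.2 hxy), by simp [h6]⟩
  let e := Equiv.ofBijective _ hbij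
  have hce : ∀ a, c (e.symm a).1 = a := fun a => e.apply_symm_apply a
  unfold dt
  rw [← Matrix.det_submatrix_equiv_self e.symm]
  refine le_of_eq (det_B6 (N := sw σ M) (fun a => (e.symm a).1) ?_)
  intro a b
  by_cases hab : a = b
  · subst hab
    have e1 := (hM.sw h.1).1 (e.symm a).1 (e.symm a).1
    have e2 := B6_skew a a
    omega
  · rw [h.2.1 _ _ (by rw [hce, hce]; exact hab), hce, hce]

theorem exists_sw {n : ℕ} {M : V → V → ℤ} (hM : TM M) {B : Fin n → Fin n → ℤ}
    (hBn : ∀ i j, i ≠ j → B i j * B i j = 1) (h : ¬ NotEmb M B) :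
    ∃ σ : V → ℤ, IsSgn σ ∧ ∃ g : Fin n → V, ∀ a b, sw σ M (g a) (g b) = B a b := by
  unfold NotEmb at h
  push Not at h
  obtain ⟨τ, hτ, g, hg⟩ := h
  have hinj : Function.Injective g := by
    intro a b hab
    by_contra hne
    have h1 := hg a b
    rw [hab] at h1
    have h2 : M (g b) (g b) = 0 := by have := hM.1 (g b) (g b); omega
    have h3 := hBn a b hne
    rw [← h1, h2] at h3
    simp at h3
  refine ⟨fun x => if hx : ∃ a, g a = x then τ hx.choose else 1, ?_, g, ?_⟩
  · intro x
    by_cases hx : ∃ a, g a = x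
    · simp only [dif_pos hx]; exact hτ _
    · simp only [dif_neg hx]; exact Or.inl trivial
  · have hs : ∀ a, (if hx : ∃ b, g b = g a then τ hx.choose else 1) = τ a := by
      intro a
      have hx : ∃ b, g b = g a := ⟨a, rfl⟩
      rw [dif_pos hx, hinj hx.choose_spec]
    intro a b
    simp only [sw]
    rw [hs, hs, hg]

theorem Blow.comp {n : ℕ} {M : V → V → ℤ} {B : Fin n → Fin n → ℤ} {c : V → Fin n}
    {σ σ' : V → ℤ} (hσ : IsSgn σ) (h : Blow (sw σ M) B c σ') :
    Blow M B c (fun x => σ' x * σ x) := by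
  have e : sw (fun x => σ' x * σ x) M = sw σ' (sw σ M) := by
    funext x y; simp only [sw]; ring
  refine ⟨fun x => ?_, ?_⟩
  · rcases hσ x with h1 | h1 <;> rcases h.1 x with h2 | h2 <;> simp [h1, h2]
  · rw [e]; exact h.2

theorem D5.sw {M : V → V → ℤ} (h : D5 M) {σ : V → ℤ} (hσ : IsSgn σ) : D5 (sw σ M) := by
  intro n f
  have := det_sgn (fun i => σ (f i)) (fun i => hσ _) (fun i j => M (f i) (f j))
  exact (le_of_eq this).trans (h n f)

theorem case6 {M : V → V → ℤ} (hM : TM M) (hD : D5 M) (h : ¬ NotEmb M B6) :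
    ∃ c σ, Blow M B6 c σ ∧ ∀ i, ∃ v, c v = i := by
  obtain ⟨σ, hσ, g, hg⟩ := exists_sw hM B6_ne h
  have hM' := hM.sw hσ
  have hD' := hD.sw hσ
  obtain ⟨c, σ', hB, hs⟩ := structure_lemma B6 B6_skew B6_ne (by norm_num) (sw σ M) hM' g hg (by
      intro v hv
      have hp : (fun j => sw σ M v (g j)) = pat (decide (sw σ M v (g 0) = 1))
          (decide (sw σ M v (g 1) = 1)) (decide (sw σ M v (g 2) = 1))
          (decide (sw σ M v (g 3) = 1)) (decide (sw σ M v (g 4) = 1))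
          (decide (sw σ M v (g 5) = 1)) := by
        have hz : ∀ j, sw σ M v (g j) = zz (decide (sw σ M v (g j) = 1)) := by
          intro j
          rcases hM'.2 v (g j) (hv j) with h | h <;> simp [h, zz]
        funext j
        fin_cases j <;> exact hz _
      rcases chk6a (decide (sw σ M v (g 0) = 1))
          (decide (sw σ M v (g 1) = 1)) (decide (sw σ M v (g 2) = 1))
          (decide (sw σ M v (g 3) = 1)) (decide (sw σ M v (g 4) = 1))
          (decide (sw σ M v (g 5) = 1)) with h | h
      · rw [hp]; exact h
      · rw [← hp] at h
        exact (notEmb_one (notEmb_bad7 hM' hD' h) _ (emb_ext hM' hg (fun b => rfl))).elim)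
    (fun i o j q hij => notEmb_bad8 hM' hD' (chk6b i o j q hij))
    (fun i => notEmb_bad8 hM' hD' (chk6c i))
  exact ⟨c, _, hB.comp hσ, hs⟩

theorem case4 {M : V → V → ℤ} (hM : TM M) (hD : D5 M) (h6 : NotEmb M B6) (h : ¬ NotEmb M B4) :
    ∃ c σ, Blow M B4 c σ := by
  obtain ⟨σ, hσ, g, hg⟩ := exists_sw hM B4_ne h
  have hM' := hM.sw hσ
  have hD' := hD.sw hσ
  obtain ⟨c, σ', hB, hs⟩ := structure_lemma B4 B4_skew B4_ne (by norm_num) (sw σ M) hM' g hg (by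
      intro v hv
      have hp : (fun j => sw σ M v (g j)) = ![zz (decide (sw σ M v (g 0) = 1)),
          zz (decide (sw σ M v (g 1) = 1)), zz (decide (sw σ M v (g 2) = 1)),
          zz (decide (sw σ M v (g 3) = 1))] := by
        have hz : ∀ j, sw σ M v (g j) = zz (decide (sw σ M v (g j) = 1)) := by
          intro j
          rcases hM'.2 v (g j) (hv j) with h | h <;> simp [h, zz]
        funext j
        fin_cases j <;> exact hz _
      rw [hp]
      exact chk4a _ _ _ _)
    (by
      intro i o j q hij
      rcases chk4b i o j q hij with h | ⟨p, _, hp⟩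
      · exact notEmb_big6 hM' hD' h
      · intro τ hτ k hk
        refine h6.sw hσ (fun a => sgnH (ext2 B4 i o j q (B4 i j)) p a * τ (p a)) ?_
          (fun a => k (p a)) ?_
        · intro a
          rcases hp.1 a with h1 | h1 <;> rcases hτ (p a) with h2 | h2 <;> simp [h1, h2]
        · intro a b
          rw [← hp.2 a b, ← hk (p a) (p b)]
          ring)
    (fun i => notEmb_big6 hM' hD' (chk4c i))
  exact ⟨c, _, hB.comp hσ⟩

theorem case1 {M : V → V → ℤ} (hM : TM M) (h : NotEmb M B4) (v : V) :
    ∃ σ, Blow M (fun _ _ => 0 : Fin 1 → Fin 1 → ℤ) (fun _ => 0) σ := by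
  let σ : V → ℤ := fun x => if x = v then 1 else M v x
  have hσ : IsSgn σ := by
    intro x
    show (if x = v then 1 else M v x) = 1 ∨ (if x = v then 1 else M v x) = -1
    split_ifs with hx
    · exact Or.inl rfl
    · exact hM.2 v x (Ne.symm hx)
  have hN := hM.sw hσ
  have hv : ∀ x, x ≠ v → sw σ M v x = 1 := by
    intro x hx
    have h1 : σ v = 1 := if_pos rfl
    have h2 : σ x = M v x := if_neg hx
    simp only [sw, h1, h2, one_mul]
    rw [← h2]; exact sgn_sq hσ x
  have hv' : ∀ x, sw σ M x v ≠ 1 := by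
    intro x hx
    by_cases hxv : x = v
    · subst hxv
      have := hN.1 x x; omega
    · have := hv x hxv
      rw [hN.1, hx] at this
      omega
  refine ⟨σ, hσ, fun x y hxy => absurd rfl hxy, ?_⟩
  rintro x y z - - ⟨hx, hy, hz⟩
  have h0 : ∀ u, sw σ M u u = 0 := fun u => by have := hN.1 u u; omega
  have hxv : x ≠ v := by rintro rfl; exact hv' _ hz
  have hyv : y ≠ v := by rintro rfl; exact hv' _ hx
  have hzv : z ≠ v := by rintro rfl; exact hv' _ hy
  refine notEmb_one (h.sw hσ) ![v, x, y, z] ?_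
  have e1 := hv x hxv
  have e2 := hv y hyv
  have e3 := hv z hzv
  have f1 := hN.1 v x
  have f2 := hN.1 v y
  have f3 := hN.1 v z
  have f4 := hN.1 x y
  have f5 := hN.1 y z
  have f6 := hN.1 z x
  rw [e1] at f1; rw [e2] at f2; rw [e3] at f3; rw [hx] at f4; rw [hy] at f5; rw [hz] at f6
  intro a b
  fin_cases a <;> fin_cases b <;> simp [B4, h0, e1, e2, e3, hx, hy, hz, f1, f2, f3, f4, f5, f6]

theorem notL6_le9 {M : V → V → ℤ} (hM : TM M) (hD : D5 M) (h6 : NotEmb M B6) (s : Finset V) :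
    dt M s ≤ 9 := by
  by_cases h4 : NotEmb M B4
  · by_cases hs : s.card ≤ 5
    · exact dt_le9 hM s hs
    have : s.Nonempty := by rw [← Finset.card_pos]; omega
    obtain ⟨v, _⟩ := this
    obtain ⟨σ, hσ⟩ := case1 hM h4 v
    exact blow_le9 (by norm_num) hM hσ s
  · obtain ⟨c, σ, hB⟩ := case4 hM hD h6 h4
    exact blow_le9 (by norm_num) hM hB s

end reduction

section final
variable {V : Type*}

theorem L6_iff : ∀ i j : Fin 6, LRel 6 i j ↔ B6 i j = 1 := by
  unfold LRel; decide +kernel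

theorem B6_pm (i j : Fin 6) (h : i ≠ j) : B6 i j = 1 ∨ B6 i j = -1 :=
  mul_self_eq_one_iff.mp (B6_ne i j h)

theorem blowup_same {a : Fin 6 → ℕ} (i : Fin 6) (p q : Fin (a i)) :
    blowup (LRel 6) a ⟨i, p⟩ ⟨i, q⟩ ↔ p < q := by
  simp [blowup, blowupG]

theorem blowup_diff {a : Fin 6 → ℕ} (x y : Σ i, Fin (a i)) (h : x.1 ≠ y.1) :
    blowup (LRel 6) a x y ↔ LRel 6 x.1 y.1 := by
  simp [blowup, blowupG, h]

/-- The skew-adjacency matrix as a plain function. -/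
noncomputable def sk (r : V → V → Prop) : V → V → ℤ := fun i j =>
  if r i j then 1 else if r j i then -1 else 0

theorem skew_TM {r : V → V → Prop} (hT : IsTournament r) : TM (sk r) := by
  constructor
  · intro x y
    by_cases hxy : x = y
    · subst hxy; simp [sk, hT.1]
    · have := hT.2 x y hxy
      by_cases h : r x y
      · simp [sk, h, this.mp h]
      · have h' : r y x := by by_contra h'; exact h (this.mpr h')
        simp [sk, h, h']
  · intro x y hxy
    have := hT.2 x y hxy
    by_cases h : r x y
    · simp [sk, h]
    · have h' : r y x := by by_contra h'; exact h (this.mpr h')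
      simp [sk, h, h']

theorem skew_eq_one_s16 {r : V → V → Prop} (x y : V) : sk r x y = 1 ↔ r x y := by
  by_cases h : r x y
  · simp [sk, h]
  · by_cases h' : r y x <;> simp [sk, h, h']

theorem sw_eq_one {r : V → V → Prop} (hT : IsTournament r) {σ : V → ℤ} (hσ : IsSgn σ)
    (x y : V) : sw σ (sk r) x y = 1 ↔ switchRel r {z | σ z = -1} x y := by
  have h1 := skew_eq_one_s16 (r := r) x y
  have h2 := skew_eq_one_s16 (r := r) y x
  have h3 := (skew_TM hT).1 x y
  rw [h3] at h2
  rcases hσ x with hx | hx <;> rcases hσ y with hy | hy <;>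
    simp [sw, switchRel, hx, hy, ← h1, ← h2]

theorem subdet_eq [Fintype V] [DecidableEq V] (r : V → V → Prop) (s : Finset V) :
    subdet r s = dt (sk r) s := by
  unfold subdet dt
  congr!

theorem dt_equiv (M : V → V → ℤ) {n : ℕ} (s : Finset V) (e : Fin n ≃ {x // x ∈ s}) :
    dt M s = (Matrix.of fun i j => M (e i).1 (e j).1).det := by
  unfold dt
  rw [← Matrix.det_submatrix_equiv_self e]
  rfl

theorem memD_det [Fintype V] [DecidableEq V] {r : V → V → Prop} {k : ℕ} (h : memD r k) {n : ℕ}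
    (f : Fin n → V) : (Matrix.of fun i j => sk r (f i) (f j)).det ≤ (k : ℤ) ^ 2 := by
  by_cases hf : Function.Injective f
  · have hs := h (Finset.univ.map ⟨f, hf⟩)
    rw [subdet_eq] at hs
    let e : Fin n ≃ {x // x ∈ Finset.univ.map ⟨f, hf⟩} :=
      Equiv.ofBijective (fun i => ⟨f i, by simp⟩) ⟨fun a b hab => hf (by simpa using hab), by
        rintro ⟨x, hx⟩
        simp at hx
        obtain ⟨a, rfl⟩ := hx
        exact ⟨a, rfl⟩⟩
    rw [dt_equiv _ _ e] at hs
    exact hs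
  · unfold Function.Injective at hf
    push Not at hf
    obtain ⟨a, b, hab, hne⟩ := hf
    rw [Matrix.det_zero_of_row_eq hne (by ext j; simp [hab])]
    positivity

theorem forward [Fintype V] {r : V → V → Prop}
    (hT : IsTournament r) {c : V → Fin 6} {σ : V → ℤ}
    (hB : Blow (sk r) B6 c σ) (hc : ∀ i, ∃ v, c v = i) :
      ∃ (a : Fin 6 → ℕ) (_ : ∀ i, 0 < a i) (e : V ≃ Σ i : Fin 6, Fin (a i)),
        SwitchEquiv r (fun i j => blowup (LRel 6) a (e i) (e j)) := by
  have hN := (skew_TM hT).sw hB.1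
  set N := sw σ (sk r) with hNdef
  have h0 : ∀ u, N u u = 0 := fun u => by have := hN.1 u u; omega
  have hsto : ∀ i, IsStrictTotalOrder {x // c x = i} (fun x y => N x.1 y.1 = 1) := by
    intro i
    refine { trichotomous := ?_, irrefl := ?_, trans := ?_ }
    · intro x y hxy hyx
      by_contra hne
      have hne' : x.1 ≠ y.1 := fun h => hne (Subtype.ext h)
      have h1 := hN.2 _ _ hne'
      have h2 := hN.1 x.1 y.1
      omega
    · intro x hx
      have := h0 x.1
      omega
    · intro x y z hxy hyz
      have hne : x.1 ≠ z.1 := by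
        intro h
        rw [h] at hxy
        have := hN.1 y.1 z.1
        omega
      rcases hN.2 _ _ hne with h | h
      · exact h
      · exact absurd ⟨hxy, hyz, by show N z.1 x.1 = 1; rw [hN.1, h]; rfl⟩
          (hB.2.2 x.1 y.1 z.1 (by rw [x.2, y.2]) (by rw [y.2, z.2]))
  let LO : ∀ i, LinearOrder {x // c x = i} := fun i =>
    @linearOrderOfSTO _ (fun x y => N x.1 y.1 = 1) (hsto i) _
  let iso : ∀ i, Fin (Fintype.card {x // c x = i}) ≃o {x // c x = i} := fun i =>
    Fintype.orderIsoFinOfCardEq _ rfl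
  let e : V ≃ Σ i : Fin 6, Fin (Fintype.card {x // c x = i}) :=
    (Equiv.sigmaFiberEquiv c).symm.trans (Equiv.sigmaCongrRight fun i => (iso i).symm.toEquiv)
  have he : ∀ x i (h : c x = i), e x = ⟨i, (iso i).symm ⟨x, h⟩⟩ := by
    intro x i h
    subst h
    rfl
  refine ⟨fun i => Fintype.card {x // c x = i}, ?_, e, {z | σ z = -1}, ?_⟩
  · intro i
    obtain ⟨v, hv⟩ := hc i
    exact Fintype.card_pos_iff.mpr ⟨⟨v, hv⟩⟩
  · intro x y
    show blowup (LRel 6) _ (e x) (e y) ↔ _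
    rw [← sw_eq_one hT hB.1]
    by_cases hxy : c x = c y
    · rw [he x _ hxy, he y _ rfl, blowup_same, OrderIso.lt_iff_lt]
      exact Iff.rfl
    · rw [blowup_diff _ _ (by rw [he x _ rfl, he y _ rfl]; exact hxy), he x _ rfl, he y _ rfl,
        L6_iff, hB.2.1 x y hxy]

theorem backward {r : V → V → Prop} (hT : IsTournament r) (a : Fin 6 → ℕ) (ha : ∀ i, 0 < a i)
    (e : V ≃ Σ i : Fin 6, Fin (a i))
    (h : SwitchEquiv r (fun i j => blowup (LRel 6) a (e i) (e j))) :
    ∃ c σ, Blow (sk r) B6 c σ ∧ ∀ i, ∃ v, c v = i := by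
  obtain ⟨W, hW⟩ := h
  let σ : V → ℤ := fun x => if x ∈ W then -1 else 1
  have hσ : IsSgn σ := by
    intro x
    by_cases hx : x ∈ W <;> simp [σ, hx]
  have hset : {z | σ z = -1} = W := by
    ext x
    by_cases hx : x ∈ W <;> simp [σ, hx]
  have hN := (skew_TM hT).sw hσ
  have hiff : ∀ x y, sw σ (sk r) x y = 1 ↔ blowup (LRel 6) a (e x) (e y) := by
    intro x y
    rw [sw_eq_one hT hσ, hset]
    exact (hW x y).symm
  refine ⟨fun x => (e x).1, σ, ⟨hσ, ?_, ?_⟩, fun i => ⟨e.symm ⟨i, ⟨0, ha i⟩⟩, by simp⟩⟩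
  · intro x y hxy
    have hxy : (e x).1 ≠ (e y).1 := hxy
    show sw σ (sk r) x y = B6 (e x).1 (e y).1
    have h1 := hiff x y
    rw [blowup_diff _ _ hxy, L6_iff] at h1
    have h2 := B6_pm _ _ hxy
    have h3 := hN.2 x y (fun h => hxy (by rw [h]))
    omega
  · rintro x y z hxy hyz ⟨h1, h2, h3⟩
    rw [hiff] at h1 h2 h3
    rcases hx : e x with ⟨i, p⟩
    rcases hy : e y with ⟨j, q⟩
    rcases hz : e z with ⟨k, s⟩
    simp only [hx, hy, hz] at hxy hyz h1 h2 h3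
    subst hxy
    subst hyz
    rw [blowup_same] at h1 h2 h3
    exact absurd (h1.trans (h2.trans h3)) (lt_irrefl _)

end final

theorem stmt16 {V : Type*} [Fintype V] [DecidableEq V] (r : V → V → Prop)
    (hT : IsTournament r) :
    (memD r 5 ∧ ¬ memD r 3) ↔
      ∃ (a : Fin 6 → ℕ) (_ : ∀ i, 0 < a i) (e : V ≃ Σ i : Fin 6, Fin (a i)),
        SwitchEquiv r (fun i j => blowup (LRel 6) a (e i) (e j)) := by
  have hM := skew_TM hT
  constructor
  · rintro ⟨h5, h3⟩
    have hD : D5 (sk r) := fun n f => by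
      simpa using memD_det h5 f
    by_cases h6 : NotEmb (sk r) B6
    · exact absurd (fun s => by
        rw [subdet_eq]; simpa using notL6_le9 hM hD h6 s) h3
    · obtain ⟨c, σ, hB, hc⟩ := case6 hM hD h6
      exact forward hT hB hc
  · rintro ⟨a, ha, e, h⟩
    obtain ⟨c, σ, hB, hc⟩ := backward hT a ha e h
    constructor
    · intro s
      rw [subdet_eq]
      simpa using blow_le25 hM hB s
    · intro h3
      choose f hf using hc
      have h1 := memD_det h3 f
      have h2 := det_sgn (fun i => σ (f i)) (fun i => hB.1 _) (fun i j => sk r (f i) (f j))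
      rw [← h2] at h1
      have h3 := det_B6 (N := sw σ (sk r)) f (by
        intro i j
        by_cases hij : i = j
        · subst hij
          have e1 := (hM.sw hB.1).1 (f i) (f i)
          have e2 := B6_skew i i
          omega
        · rw [hB.2.1 _ _ (by rw [hf, hf]; exact hij), hf, hf])
      have h4 := h1.trans_eq' h3
      norm_num at h4
end
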